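/- Let A be an irreducible k×k matrix with entries in {0,1}, and let φ : Σ_A → ℝ be a continuous function with φ(x) > 0 for all x ∈ Σ_A. Set H = sup{ h_μ(σ) / ∫ φ dμ : μ a σ-invariant Borel probability measure on Σ_A }, and assume H > 0. Then for every h ∈ (0, H) there exists an ergodic σ-invariant Borel probability measure μ on Σ_A such that h_μ(σ) / ∫ φ dμ = h. -/

import Mathlib

open MeasureTheory Real Filter Set

/-- The shift map on the full shift `ℤ → S`. -/
def shiftMap {S : Type*} : (ℤ → S) → (ℤ → S) := fun x i => x (i + 1)

/-- The subshift of finite type determined by the 0-1 matrix `A : S → S → ℕ`. -/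
def SFT {S : Type*} (A : S → S → ℕ) : Set (ℤ → S) :=
  {x | ∀ i : ℤ, A (x i) (x (i + 1)) = 1}

/-- `w : Fin n → S` is an admissible word for the 0-1 matrix `A`. -/
def IsAdmissible {S : Type*} (A : S → S → ℕ) {n : ℕ} (w : Fin n → S) : Prop :=
  ∀ (i : ℕ) (h : i + 1 < n), A (w ⟨i, Nat.lt_of_succ_lt h⟩) (w ⟨i + 1, h⟩) = 1

/-- The shift map restricted to the SFT determined by `A`. -/
def restrictShift {S : Type*} (A : S → S → ℕ) (x : ↥(SFT A)) : ↥(SFT A) :=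
  ⟨shiftMap x.1, fun i => x.2 (i + 1)⟩

open Classical in
/-- The `n`-block recoding matrix `A_n`, indexed by admissible words of length `n`:
`(b,b')`-entry is 1 iff the last `n-1` letters of `b` coincide with the first `n-1`
letters of `b'`. -/
noncomputable def blockMatrix {S : Type*} (A : S → S → ℕ) (n : ℕ) :
    {w : Fin n → S // IsAdmissible A w} → {w : Fin n → S // IsAdmissible A w} → ℕ :=
  fun b b' =>
    if ∀ (p : ℕ) (h : p + 1 < n), b.1 ⟨p + 1, h⟩ = b'.1 ⟨p, Nat.lt_of_succ_lt h⟩ then 1 else 0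

open Classical in
/-- `m`-th power of the matrix `A : S → S → ℕ`. -/
noncomputable def matPow {S : Type*} [Fintype S] (A : S → S → ℕ) : ℕ → S → S → ℕ
  | 0 => fun i j => if i = j then 1 else 0
  | (m + 1) => fun i j => ∑ r : S, matPow A m i r * A r j

/-- A nonnegative matrix is irreducible if for every `(i,j)` some power has positive
`(i,j)`-entry. -/
def IrreducibleMat {S : Type*} [Fintype S] (A : S → S → ℕ) : Prop :=
  ∀ i j : S, ∃ m : ℕ, 1 ≤ m ∧ 0 < matPow A m i j

noncomputable instance wordsFintype {S : Type*} [Fintype S] (A : S → S → ℕ) (n : ℕ) :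
    Fintype {w : Fin n → S // IsAdmissible A w} := Fintype.ofFinite _

/-- Shannon entropy of the partition of the full shift into cylinders of length `n`
(based at coordinates `0, …, n-1`). -/
noncomputable def blockH {k : ℕ} (μ : Measure (ℤ → Fin k)) (n : ℕ) : ℝ :=
  ∑ w : Fin n → Fin k,
    Real.negMulLog (μ {x | ∀ p : Fin n, x ((p : ℕ) : ℤ) = w p}).toReal

/-- The measure-theoretic (Kolmogorov–Sinai) entropy of a shift-invariant measure `μ`
on the full shift: since the coordinate partition is generating and `blockH μ` is
subadditive, it equals `inf_{n ≥ 1} blockH μ n / n`. -/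
noncomputable def mEntropy {k : ℕ} (μ : Measure (ℤ → Fin k)) : ℝ :=
  ⨅ n : ℕ, blockH μ (n + 1) / (n + 1)

/-- The number of admissible words of length `n` for `A`. -/
noncomputable def wordCount {k : ℕ} (A : Fin k → Fin k → ℕ) (n : ℕ) : ℕ :=
  Nat.card {w : Fin n → Fin k // IsAdmissible A w}

/-- The topological entropy of the SFT determined by an irreducible matrix `A`:
the exponential growth rate of the number of admissible words, which by
subadditivity equals `inf_{n ≥ 1} (log wordCount n) / n`. -/
noncomputable def topEnt {k : ℕ} (A : Fin k → Fin k → ℕ) : ℝ :=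
  ⨅ n : ℕ, Real.log (wordCount A (n + 1)) / (n + 1)

/-- `μ` is a `σ`-invariant Borel probability measure carried by the SFT `Σ_A`. -/
def InvProbOn {k : ℕ} (A : Fin k → Fin k → ℕ) (μ : Measure (ℤ → Fin k)) : Prop :=
  IsProbabilityMeasure μ ∧ MeasurePreserving shiftMap μ μ ∧ μ (SFT A) = 1

open Topology

section Words

variable {k : ℕ}

/-- Translation of bi-infinite sequences by `a`. -/
def slide (a : ℤ) (x : ℤ → Fin k) : ℤ → Fin k := fun i => x (i + a)

/-- The word read by a bi-infinite sequence at the positions `0, …, j - 1`. -/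
def word (j : ℕ) (x : ℤ → Fin k) : Fin j → Fin k := fun p => x ((p : ℕ) : ℤ)

/-- A bi-infinite sequence reading the word `w` at the positions `0, …, j - 1`. -/
def extendWord [NeZero k] (j : ℕ) (w : Fin j → Fin k) : ℤ → Fin k :=
  fun i => if h : 0 ≤ i ∧ i < j then w ⟨i.toNat, by omega⟩ else 0

theorem slide_slide (a b : ℤ) (x : ℤ → Fin k) :
    slide a (slide b x) = slide (a + b) x := by
  funext i; simp [slide, add_assoc]

theorem slide_zero (x : ℤ → Fin k) : slide 0 x = x := by
  funext i; simp [slide]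

theorem word_eq_iff {j : ℕ} {x y : ℤ → Fin k} :
    word j x = word j y ↔ ∀ i : ℤ, 0 ≤ i → i < j → x i = y i := by
  constructor
  · intro h i h0 h1
    have := congrFun h ⟨i.toNat, by omega⟩
    simpa [word, h0] using this
  · intro h
    funext p
    exact h _ (by omega) (by omega)

theorem word_extendWord [NeZero k] {j : ℕ} (w : Fin j → Fin k) : word j (extendWord j w) = w := by
  funext p
  simp [word, extendWord]

theorem extendWord_word_apply [NeZero k] {j : ℕ} (x : ℤ → Fin k) {i : ℤ} (h0 : 0 ≤ i) (h1 : i < j) :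
    extendWord j (word j x) i = x i := by
  simp [extendWord, word, h0, h1]

theorem word_mono {i j : ℕ} (h : i ≤ j) {x y : ℤ → Fin k} (hxy : word j x = word j y) :
    word i x = word i y := by
  rw [word_eq_iff] at *
  intro l h0 h1
  exact hxy l h0 (by omega)

theorem word_slide {i j a : ℕ} (h : a + i ≤ j) {x y : ℤ → Fin k} (hxy : word j x = word j y) :
    word i (slide a x) = word i (slide a y) := by
  rw [word_eq_iff] at *
  intro l h0 h1
  exact hxy _ (by omega) (by omega)

theorem continuous_slide (a : ℤ) : Continuous (slide a : (ℤ → Fin k) → _) :=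
  continuous_pi fun i => continuous_apply (i + a)

theorem continuous_word (j : ℕ) : Continuous (word j : (ℤ → Fin k) → _) :=
  continuous_pi fun _ => continuous_apply _

theorem measurable_slide (a : ℤ) : Measurable (slide a : (ℤ → Fin k) → _) :=
  measurable_pi_lambda _ fun i => measurable_pi_apply (i + a)

theorem measurable_word (j : ℕ) : Measurable (word j : (ℤ → Fin k) → _) :=
  measurable_pi_lambda _ fun _ => measurable_pi_apply _

theorem measurableSet_word (j : ℕ) (D : Set (Fin j → Fin k)) : MeasurableSet (word j ⁻¹' D) :=
  measurable_word j (Set.toFinite D).measurableSet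

/-- The probability of the cylinder of length `j` containing `x`. -/
noncomputable def cylProb (μ : Measure (ℤ → Fin k)) (j : ℕ) (x : ℤ → Fin k) : ℝ :=
  μ.real (word j ⁻¹' {word j x})

theorem cylProb_nonneg (μ : Measure (ℤ → Fin k)) (j : ℕ) (x : ℤ → Fin k) : 0 ≤ cylProb μ j x :=
  measureReal_nonneg

theorem cylProb_congr (μ : Measure (ℤ → Fin k)) {j : ℕ} {x y : ℤ → Fin k}
    (h : word j x = word j y) : cylProb μ j x = cylProb μ j y := by
  rw [cylProb, h, cylProb]

theorem cylProb_extendWord [NeZero k] (μ : Measure (ℤ → Fin k)) {j : ℕ} (w : Fin j → Fin k) :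
    cylProb μ j (extendWord j w) = μ.real (word j ⁻¹' {w}) := by
  rw [cylProb, word_extendWord]

theorem blockH_eq_sum (μ : Measure (ℤ → Fin k)) (j : ℕ) :
    blockH μ j = ∑ w : Fin j → Fin k, Real.negMulLog (μ.real (word j ⁻¹' {w})) := by
  unfold blockH
  refine Finset.sum_congr rfl fun w _ => ?_
  rw [Measure.real, show {x : ℤ → Fin k | ∀ p : Fin j, x ((p : ℕ) : ℤ) = w p} = word j ⁻¹' {w} by
    ext x; simp [word, funext_iff]]

theorem integral_word (μ : Measure (ℤ → Fin k)) [IsFiniteMeasure μ] (j : ℕ)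
    (f : (Fin j → Fin k) → ℝ) :
    ∫ x, f (word j x) ∂μ = ∑ w, μ.real (word j ⁻¹' {w}) * f w := by
  rw [← integral_map (φ := word j) (measurable_word j).aemeasurable
    (measurable_of_finite f).aestronglyMeasurable, integral_fintype Integrable.of_finite]
  congr! 1 with w
  rw [map_measureReal_apply (measurable_word j) (measurableSet_singleton w), smul_eq_mul]

theorem integrable_word (μ : Measure (ℤ → Fin k)) [IsFiniteMeasure μ] (j : ℕ)
    (f : (Fin j → Fin k) → ℝ) : Integrable (fun x => f (word j x)) μ :=
  (Integrable.of_finite (f := f) (μ := μ.map (word j))).comp_measurable (measurable_word j)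

/-- Functions of the first `j` letters are integrated by summing over words. -/
theorem integral_eq_sum [NeZero k] (μ : Measure (ℤ → Fin k)) [IsFiniteMeasure μ] (j : ℕ)
    {f : (ℤ → Fin k) → ℝ} (hf : ∀ x y, word j x = word j y → f x = f y) :
    Integrable f μ ∧ ∫ x, f x ∂μ = ∑ w, μ.real (word j ⁻¹' {w}) * f (extendWord j w) := by
  have h : f = fun x => (fun w => f (extendWord j w)) (word j x) := by
    funext x; exact hf _ _ (by rw [word_extendWord])
  constructor
  · rw [h]; exact integrable_word μ j (fun w => f (extendWord j w))
  · rw [← integral_word μ j (fun w => f (extendWord j w))]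
    exact congrArg _ (funext fun x => hf _ _ (by rw [word_extendWord]))

theorem blockH_eq_integral [NeZero k] (μ : Measure (ℤ → Fin k)) [IsFiniteMeasure μ] (j : ℕ) :
    blockH μ j = ∫ x, -Real.log (cylProb μ j x) ∂μ := by
  rw [blockH_eq_sum, (integral_eq_sum μ j fun x y h => by rw [cylProb_congr μ h]).2]
  refine Finset.sum_congr rfl fun w _ => ?_
  rw [cylProb_extendWord, Real.negMulLog]; ring

theorem ae_cylProb_pos (μ : Measure (ℤ → Fin k)) [IsFiniteMeasure μ] (j : ℕ) :
    ∀ᵐ x ∂μ, 0 < cylProb μ j x := by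
  have : {x | ¬ 0 < cylProb μ j x} ⊆
      ⋃ w ∈ {w : Fin j → Fin k | μ (word j ⁻¹' {w}) = 0}, word j ⁻¹' {w} := by
    intro x hx
    have := le_antisymm (not_lt.1 hx) (cylProb_nonneg μ j x)
    rw [cylProb] at this
    simp only [mem_iUnion]
    exact ⟨word j x, by simpa [measureReal_eq_zero_iff] using this, rfl⟩
  exact measure_mono_null this ((measure_biUnion_null_iff (Set.to_countable _)).2 fun w hw => hw)

/-- The measure of a set of words is the sum over words. -/
theorem measureReal_word (μ : Measure (ℤ → Fin k)) [IsFiniteMeasure μ] (j : ℕ)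
    (D : Set (Fin j → Fin k)) [DecidablePred (· ∈ D)] :
    μ.real (word j ⁻¹' D) = ∑ w, if w ∈ D then μ.real (word j ⁻¹' {w}) else 0 := by
  classical
  have h := integral_word μ j (D.indicator fun _ => 1)
  rw [show (fun x => D.indicator (fun _ => (1 : ℝ)) (word j x)) = (word j ⁻¹' D).indicator 1 from rfl,
    integral_indicator_one (measurableSet_word j D)] at h
  rw [h]
  refine Finset.sum_congr rfl fun w _ => ?_
  by_cases hw : w ∈ D <;> simp [hw]

theorem sum_snoc (μ : Measure (ℤ → Fin k)) [IsFiniteMeasure μ] {j : ℕ} (w : Fin j → Fin k) :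
    ∑ s, μ.real (word (j + 1) ⁻¹' {Fin.snoc w s}) = μ.real (word j ⁻¹' {w}) := by
  rw [← measureReal_iUnion_fintype]
  · congr 1
    ext x
    simp only [mem_iUnion, mem_preimage, mem_singleton_iff]
    constructor
    · rintro ⟨s, hs⟩
      funext p
      simpa [word] using congrFun hs p.castSucc
    · intro h
      refine ⟨x j, ?_⟩
      rw [← h]
      funext p
      refine Fin.lastCases ?_ (fun p => ?_) p <;> simp [word]
  · intro s t hst
    refine Disjoint.preimage _ ?_
    rw [Set.disjoint_singleton]
    exact fun h => hst (by simpa using congrFun h (Fin.last j))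
  · exact fun s => measurableSet_word _ _

theorem sum_cons (μ : Measure (ℤ → Fin k)) [IsFiniteMeasure μ]
    (hμ : MeasurePreserving (slide 1) μ μ) {j : ℕ} (w : Fin j → Fin k) :
    ∑ s, μ.real (word (j + 1) ⁻¹' {Fin.cons s w}) = μ.real (word j ⁻¹' {w}) := by
  rw [← hμ.measureReal_preimage (measurableSet_word j {w}).nullMeasurableSet,
    ← measureReal_iUnion_fintype]
  · congr 1
    ext x
    simp only [mem_iUnion, mem_preimage, mem_singleton_iff]
    constructor
    · rintro ⟨s, hs⟩
      funext p
      simpa [word, slide] using congrFun hs p.succ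
    · intro h
      refine ⟨x 0, ?_⟩
      rw [← h]
      funext p
      refine Fin.cases ?_ (fun p => ?_) p <;> simp [word, slide]
  · intro s t hst
    refine Disjoint.preimage _ ?_
    rw [Set.disjoint_singleton]
    exact fun h => hst (by simpa using congrFun h 0)
  · exact fun s => measurableSet_word _ _

end Words

section Windows

variable {k : ℕ}

/-- A measurable cylinder only depends on the letters in some window `[-R, R)`. -/
theorem exists_window_of_mem_measurableCylinders {C : Set (ℤ → Fin k)}
    (hC : C ∈ measurableCylinders fun _ : ℤ => Fin k) :
    ∃ R : ℕ, ∀ x y : ℤ → Fin k, (∀ i : ℤ, -R ≤ i → i < R → x i = y i) → (x ∈ C ↔ y ∈ C) := by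
  obtain ⟨s, S, -, rfl⟩ := (mem_measurableCylinders _).1 hC
  refine ⟨s.sup Int.natAbs + 1, fun x y h => ?_⟩
  rw [mem_cylinder, mem_cylinder]
  have : s.restrict x = s.restrict y := by
    funext i
    have := Finset.le_sup (f := Int.natAbs) i.2
    exact h _ (by push_cast; omega) (by push_cast; omega)
  rw [this]

theorem slide_extendWord_apply [NeZero k] {R : ℕ} (x : ℤ → Fin k) {J : ℕ} (hJ : 2 * R ≤ J) {i : ℤ}
    (h0 : -R ≤ i) (h1 : i < R) :
    slide R (extendWord J (word J (slide (-R) x))) i = x i := by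
  rw [slide, extendWord_word_apply _ (by omega) (by omega), slide]
  congr 1; ring

/-- Every measurable cylinder is determined by the word read in a symmetric window. -/
theorem exists_eq_preimage_word {C : Set (ℤ → Fin k)} [NeZero k]
    (hC : C ∈ measurableCylinders fun _ : ℤ => Fin k) (n : ℕ) :
    ∃ R : ℕ, n ≤ R ∧ ∃ D : Set (Fin (2 * R) → Fin k),
      C = slide (-R) ⁻¹' (word (2 * R) ⁻¹' D) := by
  obtain ⟨R, hR⟩ := exists_window_of_mem_measurableCylinders hC
  refine ⟨max n R, le_max_left _ _, {w | slide (max n R : ℕ) (extendWord _ w) ∈ C}, ?_⟩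
  ext x
  rw [mem_preimage, mem_preimage]
  refine hR _ _ fun i h0 h1 => ?_
  rw [slide_extendWord_apply _ le_rfl (by push_cast; omega) (by push_cast; omega)]

/-- Probability measures are determined by the probabilities of long words. -/
theorem ext_of_word [NeZero k] {μ ν : Measure (ℤ → Fin k)} [IsProbabilityMeasure μ]
    [IsProbabilityMeasure ν] (n : ℕ)
    (h : ∀ j, n ≤ j → ∀ (a : ℤ) (w : Fin j → Fin k),
      μ.real (slide a ⁻¹' (word j ⁻¹' {w})) = ν.real (slide a ⁻¹' (word j ⁻¹' {w}))) : μ = ν := by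
  classical
  refine ext_of_generate_finite _ (generateFrom_measurableCylinders (α := fun _ : ℤ => Fin k)).symm
    (isPiSystem_measurableCylinders (α := fun _ : ℤ => Fin k)) (fun C hC => ?_) (by simp)
  obtain ⟨R, hR, D, rfl⟩ := exists_eq_preimage_word hC n
  rw [← measureReal_eq_measureReal_iff,
    ← map_measureReal_apply (measurable_slide _) (measurableSet_word _ _),
    ← map_measureReal_apply (measurable_slide _) (measurableSet_word _ _)]
  have := Measure.isProbabilityMeasure_map (μ := μ) (measurable_slide (k := k) (-(R : ℤ))).aemeasurable
  have := Measure.isProbabilityMeasure_map (μ := ν) (measurable_slide (k := k) (-(R : ℤ))).aemeasurable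
  rw [measureReal_word, measureReal_word]
  refine Finset.sum_congr rfl fun w _ => ?_
  rw [map_measureReal_apply (measurable_slide _) (measurableSet_word _ _),
    map_measureReal_apply (measurable_slide _) (measurableSet_word _ _), h _ (by omega)]

/-- The measure on words of length `j` with weights `F j`. -/
noncomputable def wordMeasure (F : ∀ j, (Fin j → Fin k) → ℝ) (j : ℕ) : Measure (Fin j → Fin k) :=
  ∑ w, ENNReal.ofReal (F j w) • Measure.dirac w

instance (F : ∀ j, (Fin j → Fin k) → ℝ) (j : ℕ) : IsFiniteMeasure (wordMeasure F j) := by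
  constructor
  simp [wordMeasure]

variable {F : ∀ j, (Fin j → Fin k) → ℝ}

theorem wordMeasure_singleton (h0 : ∀ j w, 0 ≤ F j w) (j : ℕ) (w : Fin j → Fin k) :
    (wordMeasure F j).real {w} = F j w := by
  classical
  rw [Measure.real, wordMeasure, Measure.finsetSum_apply]
  rw [Finset.sum_eq_single w]
  · simp [h0]
  · intro v _ hv; simp [hv]
  · simp

theorem map_init_wordMeasure (h0 : ∀ j w, 0 ≤ F j w) {j : ℕ}
    (h : ∀ w : Fin j → Fin k, ∑ s, F (j + 1) (Fin.snoc w s) = F j w) :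
    (wordMeasure F (j + 1)).map (Fin.init : (Fin (j + 1) → Fin k) → _) = wordMeasure F j := by
  refine Measure.ext_of_singleton fun w => ?_
  rw [← measureReal_eq_measureReal_iff,
    map_measureReal_apply (measurable_of_finite _) (measurableSet_singleton w),
    wordMeasure_singleton h0, ← h w]
  simp_rw [← wordMeasure_singleton h0]
  rw [← measureReal_iUnion_fintype]
  · congr 1
    ext v
    simp only [mem_iUnion, mem_preimage, mem_singleton_iff]
    constructor
    · rintro rfl; exact ⟨v (Fin.last j), by simp⟩
    · rintro ⟨s, rfl⟩; simp
  · intro s t hst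
    rw [Function.onFun, Set.disjoint_singleton]
    exact fun h => hst (by simpa using congrFun h (Fin.last j))
  · exact fun s => measurableSet_singleton _

theorem map_tail_wordMeasure (h0 : ∀ j w, 0 ≤ F j w) {j : ℕ}
    (h : ∀ w : Fin j → Fin k, ∑ s, F (j + 1) (Fin.cons s w) = F j w) :
    (wordMeasure F (j + 1)).map (Fin.tail : (Fin (j + 1) → Fin k) → _) = wordMeasure F j := by
  refine Measure.ext_of_singleton fun w => ?_
  rw [← measureReal_eq_measureReal_iff,
    map_measureReal_apply (measurable_of_finite _) (measurableSet_singleton w),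
    wordMeasure_singleton h0, ← h w]
  simp_rw [← wordMeasure_singleton h0]
  rw [← measureReal_iUnion_fintype]
  · congr 1
    ext v
    simp only [mem_iUnion, mem_preimage, mem_singleton_iff]
    constructor
    · rintro rfl; exact ⟨v 0, by simp⟩
    · rintro ⟨s, rfl⟩; simp
  · intro s t hst
    rw [Function.onFun, Set.disjoint_singleton]
    exact fun h => hst (by simpa using congrFun h 0)
  · exact fun s => measurableSet_singleton _

variable [NeZero k] {n : ℕ}

theorem extendWord_init {J : ℕ} (w : Fin (J + 1) → Fin k) {i : ℤ} (h1 : i < J) :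
    extendWord J (Fin.init w) i = extendWord (J + 1) w i := by
  by_cases h0 : 0 ≤ i
  · rw [extendWord, extendWord, dif_pos ⟨h0, h1⟩, dif_pos ⟨h0, by push_cast; omega⟩]
    rfl
  · rw [extendWord, extendWord, dif_neg (by tauto), dif_neg (by tauto)]

theorem extendWord_tail {J : ℕ} (w : Fin (J + 1) → Fin k) {i : ℤ} (h0 : 0 ≤ i) :
    extendWord J (Fin.tail w) i = extendWord (J + 1) w (i + 1) := by
  by_cases h1 : i < J
  · rw [extendWord, extendWord, dif_pos ⟨h0, h1⟩, dif_pos ⟨by omega, by push_cast; omega⟩, Fin.tail]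
    congr 1
    ext
    simp only [Fin.val_succ]
    omega
  · rw [extendWord, extendWord, dif_neg (by tauto), dif_neg (by push_cast; omega)]

theorem map_window_wordMeasure (h0 : ∀ j w, 0 ≤ F j w)
    (hsnoc : ∀ j, n ≤ j → ∀ w : Fin j → Fin k, ∑ s, F (j + 1) (Fin.snoc w s) = F j w)
    (hcons : ∀ j, n ≤ j → ∀ w : Fin j → Fin k, ∑ s, F (j + 1) (Fin.cons s w) = F j w)
    (J : ℕ) : ∀ a j : ℕ, n ≤ j → a + j ≤ J →
      (wordMeasure F J).map (fun w => word j (slide a (extendWord J w))) = wordMeasure F j := by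
  have base : ∀ J, (wordMeasure F J).map (fun w => word J (slide (0 : ℕ) (extendWord J w))) =
      wordMeasure F J := by
    intro J
    simp [slide_zero, word_extendWord]
  induction J with
  | zero =>
    intro a j _ h
    obtain rfl : a = 0 := by omega
    obtain rfl : j = 0 := by omega
    exact base 0
  | succ J ih =>
    intro a j hj h
    by_cases h1 : a + j ≤ J
    · rw [← ih a j hj h1, ← map_init_wordMeasure h0 (hsnoc J (by omega)),
        Measure.map_map (measurable_of_finite _) (measurable_of_finite _)]
      congr 1
      funext w
      rw [Function.comp, word_eq_iff]
      intro i hi0 hi1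
      rw [slide, slide, extendWord_init _ (by omega)]
    · cases a with
      | zero =>
        obtain rfl : j = J + 1 := by omega
        exact base _
      | succ a =>
        rw [← ih a j hj (by omega), ← map_tail_wordMeasure h0 (hcons J (by omega)),
          Measure.map_map (measurable_of_finite _) (measurable_of_finite _)]
        congr 1
        funext w
        rw [Function.comp, word_eq_iff]
        intro i hi0 hi1
        rw [slide, slide, extendWord_tail _ (by omega)]
        congr 1
        push_cast; ring

omit [NeZero k] in
theorem isProbabilityMeasure_wordMeasure (h0 : ∀ j w, 0 ≤ F j w)
    (hsnoc : ∀ j, n ≤ j → ∀ w : Fin j → Fin k, ∑ s, F (j + 1) (Fin.snoc w s) = F j w)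
    (hsum : ∑ w, F n w = 1) {j : ℕ} (hj : n ≤ j) : IsProbabilityMeasure (wordMeasure F j) := by
  constructor
  induction j, hj using Nat.le_induction with
  | base =>
    simp only [wordMeasure, Measure.finsetSum_apply, Measure.smul_apply, measure_univ, smul_eq_mul,
      mul_one]
    rw [← ENNReal.ofReal_sum_of_nonneg fun w _ => h0 _ w, hsum, ENNReal.ofReal_one]
  | succ j hj ih =>
    rw [← ih, ← map_init_wordMeasure h0 (hsnoc j hj),
      Measure.map_apply (measurable_of_finite _) .univ, preimage_univ]

/-- Consistent weights on words are the word probabilities of a probability measure. -/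
theorem exists_measure_of_consistent (h0 : ∀ j w, 0 ≤ F j w)
    (hsnoc : ∀ j, n ≤ j → ∀ w : Fin j → Fin k, ∑ s, F (j + 1) (Fin.snoc w s) = F j w)
    (hcons : ∀ j, n ≤ j → ∀ w : Fin j → Fin k, ∑ s, F (j + 1) (Fin.cons s w) = F j w)
    (hsum : ∑ w, F n w = 1) :
    ∃ μ : Measure (ℤ → Fin k), IsProbabilityMeasure μ ∧ ∀ j, n ≤ j → ∀ (a : ℤ) (w : Fin j → Fin k),
      μ.real (slide a ⁻¹' (word j ⁻¹' {w})) = F j w := by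
  have hprob : ∀ N : ℕ, IsProbabilityMeasure
      ((wordMeasure F (2 * (N + n))).map fun w => slide (N + n : ℕ) (extendWord _ w)) := fun N =>
    have := isProbabilityMeasure_wordMeasure h0 hsnoc hsum (j := 2 * (N + n)) (by omega)
    Measure.isProbabilityMeasure_map (measurable_of_finite _).aemeasurable
  let μs : ℕ → ProbabilityMeasure (ℤ → Fin k) := fun N => ⟨_, hprob N⟩
  obtain ⟨μ, -, hμ⟩ := isCompact_univ.ultrafilter_le_nhds ((hyperfilter ℕ).map μs) (by simp)
  refine ⟨μ, inferInstance, fun j hj a w => ?_⟩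
  have hclopen : IsClopen (slide a ⁻¹' (word j ⁻¹' {w}) : Set (ℤ → Fin k)) :=
    (isClopen_discrete {w}).preimage ((continuous_word j).comp (continuous_slide a))
  have hlim := ProbabilityMeasure.tendsto_measure_of_null_frontier_of_tendsto' (E := slide a ⁻¹' (word j ⁻¹' {w}))
    (show Tendsto μs (hyperfilter ℕ) (𝓝 μ) from hμ) (by simp [hclopen.frontier_eq])
  have hev : ∀ᶠ N in (hyperfilter ℕ : Filter ℕ),
      (μs N : Measure (ℤ → Fin k)) (slide a ⁻¹' (word j ⁻¹' {w})) = wordMeasure F j {w} := by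
    refine Nat.hyperfilter_le_atTop (eventually_atTop.2 ⟨a.natAbs + j, fun N hN => ?_⟩)
    simp only [μs, ProbabilityMeasure.coe_mk]
    obtain ⟨b, hb⟩ := Int.eq_ofNat_of_zero_le (show 0 ≤ a + (N + n : ℕ) by omega)
    rw [Measure.map_apply (measurable_of_finite _) hclopen.1.measurableSet,
      ← map_window_wordMeasure h0 hsnoc hcons (2 * (N + n)) b j hj (by omega),
      Measure.map_apply (measurable_of_finite _) (measurableSet_singleton w)]
    congr 1
    ext u
    simp only [mem_preimage, slide_slide, hb]
  rw [← wordMeasure_singleton h0 j w, Measure.real, Measure.real,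
    tendsto_nhds_unique hlim (tendsto_const_nhds.congr' (hev.mono fun _ h => h.symm))]

end Windows

section Markov

variable {k : ℕ} {μ ν : Measure (ℤ → Fin k)}

theorem measurePreserving_slide (hμ : MeasurePreserving (slide 1) μ μ) (a : ℤ) :
    MeasurePreserving (slide a) μ μ := by
  have hneg : MeasurePreserving (slide (-1)) μ μ := by
    refine ⟨measurable_slide _, ?_⟩
    conv_lhs => rw [← hμ.map_eq]
    rw [Measure.map_map (measurable_slide _) (measurable_slide _)]
    convert Measure.map_id
    funext x
    simp [slide_slide, slide_zero]
  induction a using Int.induction_on with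
  | zero =>
    convert MeasurePreserving.id μ
    funext x
    simp [slide_zero]
  | succ a ih =>
    convert hμ.comp ih using 1
    funext x
    simp [slide_slide, add_comm]
  | pred a ih =>
    convert hneg.comp ih using 1
    funext x
    simp [slide_slide, sub_eq_add_neg, add_comm]

theorem cylProb_antitone (μ : Measure (ℤ → Fin k)) [IsFiniteMeasure μ] {i j : ℕ} (h : i ≤ j)
    (x : ℤ → Fin k) : cylProb μ j x ≤ cylProb μ i x :=
  measureReal_mono (fun _ hy => word_mono h hy)

theorem cylProb_le_slide [IsFiniteMeasure μ] (hμ : MeasurePreserving (slide 1) μ μ) {i j a : ℕ}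
    (h : a + i ≤ j) (x : ℤ → Fin k) : cylProb μ j x ≤ cylProb μ i (slide a x) := by
  rw [cylProb, cylProb, ← (measurePreserving_slide hμ a).measureReal_preimage
    (measurableSet_word i {word i (slide a x)}).nullMeasurableSet]
  exact measureReal_mono (fun _ hy => word_slide h hy)

/-- The conditional probability of the letter at position `n` given the previous `n` ones. -/
noncomputable def transProb (μ : Measure (ℤ → Fin k)) (n : ℕ) (x : ℤ → Fin k) : ℝ :=
  cylProb μ (n + 1) x / cylProb μ n x

/-- The probability of the word of length `n + M` read by `x`, for the `n`-step Markov chain with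
the same `(n + 1)`-words as `μ`. -/
noncomputable def markovWeight (μ : Measure (ℤ → Fin k)) (n M : ℕ) (x : ℤ → Fin k) : ℝ :=
  cylProb μ n x * ∏ i ∈ Finset.range M, transProb μ n (slide i x)

theorem transProb_nonneg (μ : Measure (ℤ → Fin k)) (n : ℕ) (x : ℤ → Fin k) :
    0 ≤ transProb μ n x := div_nonneg (cylProb_nonneg _ _ _) (cylProb_nonneg _ _ _)

theorem transProb_congr (μ : Measure (ℤ → Fin k)) {n : ℕ} {x y : ℤ → Fin k}
    (h : word (n + 1) x = word (n + 1) y) : transProb μ n x = transProb μ n y := by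
  rw [transProb, cylProb_congr μ h, cylProb_congr μ (word_mono (Nat.le_succ n) h), transProb]

theorem cylProb_mul_transProb (μ : Measure (ℤ → Fin k)) [IsFiniteMeasure μ] (n : ℕ)
    (x : ℤ → Fin k) : cylProb μ n x * transProb μ n x = cylProb μ (n + 1) x := by
  rcases eq_or_ne (cylProb μ n x) 0 with h | h
  · rw [h, zero_mul]
    exact (le_antisymm (h ▸ cylProb_antitone μ (Nat.le_succ n) x) (cylProb_nonneg _ _ _)).symm
  · rw [transProb, mul_div_cancel₀ _ h]

theorem markovWeight_nonneg (μ : Measure (ℤ → Fin k)) (n M : ℕ) (x : ℤ → Fin k) :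
    0 ≤ markovWeight μ n M x :=
  mul_nonneg (cylProb_nonneg _ _ _) (Finset.prod_nonneg fun _ _ => transProb_nonneg _ _ _)

theorem markovWeight_congr (μ : Measure (ℤ → Fin k)) {n M : ℕ} {x y : ℤ → Fin k}
    (h : word (n + M) x = word (n + M) y) : markovWeight μ n M x = markovWeight μ n M y := by
  rw [markovWeight, markovWeight, cylProb_congr μ (word_mono (Nat.le_add_right n M) h)]
  congr 1
  refine Finset.prod_congr rfl fun i hi => ?_
  rw [Finset.mem_range] at hi
  exact transProb_congr μ (word_slide (by omega) h)

theorem markovWeight_zero (μ : Measure (ℤ → Fin k)) (n : ℕ) (x : ℤ → Fin k) :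
    markovWeight μ n 0 x = cylProb μ n x := by simp [markovWeight]

theorem markovWeight_succ (μ : Measure (ℤ → Fin k)) (n M : ℕ) (x : ℤ → Fin k) :
    markovWeight μ n (M + 1) x = markovWeight μ n M x * transProb μ n (slide M x) := by
  rw [markovWeight, Finset.prod_range_succ, markovWeight, mul_assoc]

theorem markovWeight_eq_zero [IsFiniteMeasure μ] (hμ : MeasurePreserving (slide 1) μ μ) {n M : ℕ}
    {x : ℤ → Fin k} (h : cylProb μ n (slide M x) = 0) : markovWeight μ n M x = 0 := by
  cases M with
  | zero => rw [markovWeight_zero]; simpa [slide_zero] using h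
  | succ M =>
    have h1 := cylProb_le_slide hμ (i := n) (j := n + 1) (a := 1) (by omega) (slide M x)
    rw [slide_slide, show ((1 : ℕ) : ℤ) + M = (M + 1 : ℕ) by push_cast; ring, h] at h1
    rw [markovWeight_succ, transProb, le_antisymm h1 (cylProb_nonneg _ _ _), zero_div, mul_zero]

variable [NeZero k]

theorem word_extendWord_snoc {j : ℕ} (w : Fin j → Fin k) (s : Fin k) :
    word j (extendWord (j + 1) (Fin.snoc w s)) = word j (extendWord j w) := by
  rw [word_eq_iff]
  intro i _ h1
  rw [← extendWord_init _ h1, Fin.init_snoc]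

theorem word_extendWord_cons {j : ℕ} (w : Fin j → Fin k) (s : Fin k) :
    word j (slide 1 (extendWord (j + 1) (Fin.cons s w))) = word j (extendWord j w) := by
  rw [word_eq_iff]
  intro i h0 _
  rw [slide, ← extendWord_tail _ h0, Fin.tail_cons]

theorem word_slide_extendWord_snoc {n M : ℕ} (w : Fin (n + M) → Fin k) (s : Fin k) :
    word (n + 1) (slide M (extendWord (n + M + 1) (Fin.snoc w s))) =
      Fin.snoc (word n (slide M (extendWord (n + M) w))) s := by
  funext p
  refine Fin.lastCases ?_ (fun p => ?_) p
  · rw [Fin.snoc_last, word, slide, extendWord, dif_pos ⟨by omega, by simp⟩]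
    convert Fin.snoc_last (α := fun _ => Fin k) s w
    simp
    omega
  · rw [Fin.snoc_castSucc, word, word, slide, slide, ← extendWord_init _ (by simp),
      Fin.init_snoc]
    rfl

theorem sum_markovWeight_snoc [IsFiniteMeasure μ] (hμ : MeasurePreserving (slide 1) μ μ)
    {n M : ℕ} (w : Fin (n + M) → Fin k) :
    ∑ s, markovWeight μ n (M + 1) (extendWord (n + M + 1) (Fin.snoc w s)) =
      markovWeight μ n M (extendWord (n + M) w) := by
  simp_rw [markovWeight_succ, markovWeight_congr μ (word_extendWord_snoc w _), ← Finset.mul_sum]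
  by_cases h : cylProb μ n (slide M (extendWord (n + M) w)) = 0
  · rw [markovWeight_eq_zero hμ h, zero_mul]
  · have : ∀ s, transProb μ n (slide M (extendWord (n + M + 1) (Fin.snoc w s))) =
        μ.real (word (n + 1) ⁻¹' {Fin.snoc (word n (slide M (extendWord (n + M) w))) s}) /
          cylProb μ n (slide M (extendWord (n + M) w)) := by
      intro s
      rw [transProb, cylProb, word_slide_extendWord_snoc,
        cylProb_congr μ (word_slide (by omega) (word_extendWord_snoc w s))]
    simp_rw [this, ← Finset.sum_div, sum_snoc]
    rw [← cylProb, div_self h, mul_one]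

theorem sum_markovWeight_cons [IsFiniteMeasure μ] (hμ : MeasurePreserving (slide 1) μ μ)
    {n M : ℕ} (w : Fin (n + M) → Fin k) :
    ∑ s, markovWeight μ n (M + 1) (extendWord (n + M + 1) (Fin.cons s w)) =
      markovWeight μ n M (extendWord (n + M) w) := by
  have h1 : ∀ s, markovWeight μ n (M + 1) (extendWord (n + M + 1) (Fin.cons s w)) =
      μ.real (word (n + 1) ⁻¹' {Fin.cons s (word n (extendWord (n + M) w))}) *
        ∏ i ∈ Finset.range M, transProb μ n (slide i (extendWord (n + M) w)) := by
    intro s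
    rw [markovWeight, Finset.prod_range_succ', mul_comm (∏ _ ∈ _, _), ← mul_assoc, Nat.cast_zero,
      slide_zero, cylProb_mul_transProb, cylProb]
    congr 1
    · congr
      funext p
      refine Fin.cases ?_ (fun p => ?_) p
      · rw [Fin.cons_zero, word, extendWord, dif_pos ⟨by simp, by simp; omega⟩]
        exact Fin.cons_zero (α := fun _ => Fin k) s w
      · rw [Fin.cons_succ, word, Fin.val_succ, word, Nat.cast_add, Nat.cast_one,
          ← extendWord_tail _ (by omega), Fin.tail_cons]
    · refine Finset.prod_congr rfl fun i hi => transProb_congr μ ?_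
      rw [Finset.mem_range] at hi
      have := word_slide (i := n + 1) (a := i) (by omega) (word_extendWord_cons w s)
      rwa [slide_slide] at this
  simp_rw [h1, ← Finset.sum_mul, sum_cons μ hμ]
  rfl

/-- `ν` is the `n`-step Markov approximation of the invariant measure `μ`. -/
structure IsMarkovApprox (n : ℕ) (μ ν : Measure (ℤ → Fin k)) : Prop where
  isProb : IsProbabilityMeasure ν
  invariant : MeasurePreserving (slide 1) ν ν
  cylProb_eq : ∀ M x, cylProb ν (n + M) x = markovWeight μ n M x

theorem exists_isMarkovApprox [IsProbabilityMeasure μ] (hμ : MeasurePreserving (slide 1) μ μ)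
    (n : ℕ) : ∃ ν : Measure (ℤ → Fin k), IsMarkovApprox n μ ν := by
  obtain ⟨ν, hν, h⟩ := exists_measure_of_consistent (n := n)
    (F := fun j w => markovWeight μ n (j - n) (extendWord j w))
    (fun _ _ => markovWeight_nonneg _ _ _ _)
    (fun j hj w => by
      obtain ⟨M, rfl⟩ := Nat.exists_eq_add_of_le hj
      rw [show n + M - n = M by omega, show n + M + 1 - n = M + 1 by omega]
      exact sum_markovWeight_snoc hμ w)
    (fun j hj w => by
      obtain ⟨M, rfl⟩ := Nat.exists_eq_add_of_le hj
      rw [show n + M - n = M by omega, show n + M + 1 - n = M + 1 by omega]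
      exact sum_markovWeight_cons hμ w)
    (by
      simp only [Nat.sub_self, markovWeight_zero, cylProb_extendWord]
      have := integral_word μ n fun _ => (1 : ℝ)
      simpa using this.symm)
  refine ⟨ν, hν, ⟨measurable_slide 1, ?_⟩, fun M x => ?_⟩
  · have := Measure.isProbabilityMeasure_map (μ := ν) (measurable_slide (k := k) 1).aemeasurable
    refine ext_of_word n fun j hj a w => ?_
    rw [map_measureReal_apply (measurable_slide _)
      (measurable_slide _ (measurableSet_word _ _)), h j hj a w, ← h j hj (a + 1) w]
    congr 1
    ext x
    simp [slide_slide]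
  · have := h (n + M) (by omega) 0 (word (n + M) x)
    rw [show n + M - n = M by omega] at this
    rw [← markovWeight_congr μ (word_extendWord (word (n + M) x)), ← this, cylProb]
    congr 1

end Markov

section Entropy

variable {k : ℕ} {μ ν : Measure (ℤ → Fin k)}

theorem blockH_nonneg (μ : Measure (ℤ → Fin k)) [IsProbabilityMeasure μ] (j : ℕ) :
    0 ≤ blockH μ j := by
  rw [blockH_eq_sum]
  exact Finset.sum_nonneg fun w _ => Real.negMulLog_nonneg measureReal_nonneg measureReal_le_one

/-- The shift by `a` as a measurable equivalence. -/
def slideEquiv (k : ℕ) (a : ℤ) : (ℤ → Fin k) ≃ᵐ (ℤ → Fin k) where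
  toFun := slide a
  invFun := slide (-a)
  left_inv x := by rw [slide_slide, neg_add_cancel, slide_zero]
  right_inv x := by rw [slide_slide, add_neg_cancel, slide_zero]
  measurable_toFun := measurable_slide a
  measurable_invFun := measurable_slide (-a)

theorem integral_slide (hμ : MeasurePreserving (slide 1) μ μ) (a : ℤ) (f : (ℤ → Fin k) → ℝ) :
    ∫ x, f (slide a x) ∂μ = ∫ x, f x ∂μ :=
  (show MeasurePreserving (slideEquiv k a) μ μ from measurePreserving_slide hμ a).integral_comp' f

theorem le_zero_of_forall_nat_mul_le {a C : ℝ} (h : ∀ M : ℕ, M * a ≤ C) : a ≤ 0 := by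
  by_contra! ha
  obtain ⟨M, hM⟩ := exists_nat_gt (C / a)
  rw [div_lt_iff₀ ha] at hM
  linarith [h M]

variable [NeZero k]

theorem sum_cylProb_mul_cylProb (μ : Measure (ℤ → Fin k)) [IsProbabilityMeasure μ] (a b : ℕ) :
    ∑ w : Fin (a + b) → Fin k, cylProb μ a (extendWord (a + b) w) *
      cylProb μ b (slide a (extendWord (a + b) w)) = 1 := by
  have hone : ∀ j, ∑ w : Fin j → Fin k, μ.real (word j ⁻¹' {w}) = 1 := fun j => by
    simpa using (integral_word μ j fun _ => (1 : ℝ)).symm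
  rw [← (Fin.appendEquiv a b).sum_comp, Fintype.sum_prod_type]
  have : ∀ u v, cylProb μ a (extendWord (a + b) (Fin.appendEquiv a b (u, v))) *
      cylProb μ b (slide a (extendWord (a + b) (Fin.appendEquiv a b (u, v)))) =
      μ.real (word a ⁻¹' {u}) * μ.real (word b ⁻¹' {v}) := by
    intro u v
    rw [cylProb, cylProb]
    congr 4
    · funext p
      rw [word, extendWord, dif_pos (by omega)]
      exact Fin.append_left u v p
    · funext p
      rw [word, slide, extendWord, dif_pos (by omega)]
      rw [← Fin.append_right u v p, Fin.appendEquiv_apply]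
      congr 1
      ext
      simp only [Fin.val_natAdd]
      omega
  simp_rw [this, ← Finset.mul_sum, hone, mul_one]
  exact hone a

theorem blockH_add_le [IsProbabilityMeasure μ] (hμ : MeasurePreserving (slide 1) μ μ) (a b : ℕ) :
    blockH μ (a + b) ≤ blockH μ a + blockH μ b := by
  have hb : blockH μ b = ∫ x, -Real.log (cylProb μ b (slide a x)) ∂μ := by
    rw [blockH_eq_integral]
    exact (integral_slide hμ a fun x => -Real.log (cylProb μ b x)).symm
  have h1 := integral_eq_sum μ (a + b) (f := fun x => -Real.log (cylProb μ (a + b) x))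
    fun x y h => by rw [cylProb_congr μ h]
  have h2 := integral_eq_sum μ (a + b) (f := fun x => -Real.log (cylProb μ a x))
    fun x y h => by rw [cylProb_congr μ (word_mono (by omega) h)]
  have h3 := integral_eq_sum μ (a + b) (f := fun x => -Real.log (cylProb μ b (slide a x)))
    fun x y h => by rw [cylProb_congr μ (word_slide le_rfl h)]
  have h4 := integral_eq_sum μ (a + b)
    (f := fun x => cylProb μ a x * cylProb μ b (slide a x) / cylProb μ (a + b) x - 1)
    fun x y h => by
      rw [cylProb_congr μ h, cylProb_congr μ (word_slide le_rfl h),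
        cylProb_congr μ (word_mono (by omega) h)]
  have h5 : ∫ x, (cylProb μ a x * cylProb μ b (slide a x) / cylProb μ (a + b) x - 1) ∂μ ≤ 0 := by
    rw [h4.2, ← sub_self (1 : ℝ)]
    simp_rw [mul_sub, Finset.sum_sub_distrib, mul_one]
    gcongr ?_ - ?_
    · rw [← sum_cylProb_mul_cylProb μ a b]
      refine Finset.sum_le_sum fun w _ => ?_
      rw [cylProb_extendWord]
      rcases eq_or_ne (μ.real (word (a + b) ⁻¹' {w})) 0 with h | h
      · rw [h, zero_mul]; exact mul_nonneg (cylProb_nonneg _ _ _) (cylProb_nonneg _ _ _)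
      · rw [mul_div_cancel₀ _ h]
    · exact le_of_eq (by simpa using (integral_word μ (a + b) fun _ => (1 : ℝ)))
  have h6 : ∫ x, (-Real.log (cylProb μ (a + b) x) - -Real.log (cylProb μ a x) -
      -Real.log (cylProb μ b (slide a x))) ∂μ ≤
      ∫ x, (cylProb μ a x * cylProb μ b (slide a x) / cylProb μ (a + b) x - 1) ∂μ := by
    refine integral_mono_ae ((h1.1.sub h2.1).sub h3.1) h4.1 ?_
    filter_upwards [ae_cylProb_pos μ (a + b)] with x hx
    have ha : 0 < cylProb μ a x := hx.trans_le (cylProb_antitone μ (by omega) x)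
    have hb : 0 < cylProb μ b (slide a x) := hx.trans_le (cylProb_le_slide hμ le_rfl x)
    have := Real.log_le_sub_one_of_pos (div_pos (mul_pos ha hb) hx)
    rw [Real.log_div (mul_pos ha hb).ne' hx.ne', Real.log_mul ha.ne' hb.ne'] at this
    linarith
  have h7 : Integrable (fun x => -Real.log (cylProb μ (a + b) x) - -Real.log (cylProb μ a x)) μ :=
    h1.1.sub h2.1
  rw [integral_sub h7 h3.1, integral_sub h1.1 h2.1, ← hb, ← blockH_eq_integral,
    ← blockH_eq_integral] at h6
  linarith

theorem tendsto_blockH_div [IsProbabilityMeasure μ] (hμ : MeasurePreserving (slide 1) μ μ) :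
    Tendsto (fun j : ℕ => blockH μ j / j) atTop (𝓝 (mEntropy μ)) := by
  have hsub : Subadditive (blockH μ) := blockH_add_le hμ
  have hbdd : BddBelow (range fun j : ℕ => blockH μ j / j) :=
    ⟨0, by rintro _ ⟨j, rfl⟩; exact div_nonneg (blockH_nonneg μ j) j.cast_nonneg⟩
  convert hsub.tendsto_lim hbdd
  rw [Subadditive.lim, mEntropy, iInf]
  congr 1
  ext r
  constructor
  · rintro ⟨j, rfl⟩
    exact ⟨j + 1, by simp, by simp⟩
  · rintro ⟨j, hj, rfl⟩
    obtain ⟨i, rfl⟩ := Nat.exists_eq_add_of_le' (show 1 ≤ j from hj)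
    exact ⟨i, by simp⟩

omit [NeZero k] in
theorem mul_mEntropy_le (μ : Measure (ℤ → Fin k)) [IsProbabilityMeasure μ] (j : ℕ) :
    j * mEntropy μ ≤ blockH μ j := by
  cases j with
  | zero => simpa using blockH_nonneg μ 0
  | succ j =>
    have h : mEntropy μ ≤ blockH μ (j + 1) / (j + 1) :=
      ciInf_le ⟨0, by
        rintro _ ⟨j, rfl⟩
        exact div_nonneg (blockH_nonneg μ _) (by positivity)⟩ j
    rw [le_div_iff₀ (by positivity)] at h
    push_cast
    linarith

omit [NeZero k] in
theorem mEntropy_le_of_forall_sub_le [IsProbabilityMeasure μ] {N : ℕ} {c : ℝ}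
    (h : ∀ j, N ≤ j → blockH μ (j + 1) - blockH μ j ≤ c) : mEntropy μ ≤ c := by
  have h1 : ∀ M : ℕ, blockH μ (N + M) ≤ blockH μ N + M * c := by
    intro M
    induction M with
    | zero => simp
    | succ M ih =>
      have := h (N + M) (by omega)
      rw [← add_assoc]
      push_cast
      linarith
  have := le_zero_of_forall_nat_mul_le (a := mEntropy μ - c) (C := blockH μ N - N * mEntropy μ)
    fun M => by
      have h2 := mul_mEntropy_le μ (N + M)
      push_cast at h2
      linarith [h1 M]
  linarith

theorem le_mEntropy_of_forall_le_sub [IsProbabilityMeasure μ]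
    (hμ : MeasurePreserving (slide 1) μ μ) {N : ℕ} {c : ℝ}
    (h : ∀ j, N ≤ j → c ≤ blockH μ (j + 1) - blockH μ j) : c ≤ mEntropy μ := by
  have h1 : ∀ M : ℕ, blockH μ N + M * c ≤ blockH μ (N + M) := by
    intro M
    induction M with
    | zero => simp
    | succ M ih =>
      have := h (N + M) (by omega)
      rw [← add_assoc]
      push_cast
      linarith
  refine le_of_forall_gt_imp_ge_of_dense fun e he => ?_
  obtain ⟨J, hJ⟩ := eventually_atTop.1 ((tendsto_blockH_div hμ).eventually_lt_const he)
  have := le_zero_of_forall_nat_mul_le (a := c - e)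
    (C := (N + J + 1) * e - blockH μ N - (J + 1) * c)
    fun M => by
      have h2 := h1 (J + 1 + M)
      have h3 := hJ (N + (J + 1 + M)) (by omega)
      rw [div_lt_iff₀ (by push_cast; positivity)] at h3
      push_cast at h2 h3
      linarith
  linarith

omit [NeZero k] in
/-- The conditional block entropies are frequently at least the entropy minus any `η`. -/
theorem exists_mEntropy_sub_lt [IsProbabilityMeasure μ] (N : ℕ) {c : ℝ} (hc : c < mEntropy μ) :
    ∃ n, N ≤ n ∧ c < blockH μ (n + 1) - blockH μ n := by
  by_contra! h
  exact hc.not_ge (mEntropy_le_of_forall_sub_le h)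

namespace IsMarkovApprox

variable {n : ℕ}

omit [NeZero k] in
theorem cylProb_eq_self (h : IsMarkovApprox n μ ν) (x : ℤ → Fin k) :
    cylProb ν n x = cylProb μ n x := by
  rw [← markovWeight_zero μ, ← h.cylProb_eq, add_zero]

omit [NeZero k] in
theorem cylProb_eq_succ [IsFiniteMeasure μ] (h : IsMarkovApprox n μ ν) (x : ℤ → Fin k) :
    cylProb ν (n + 1) x = cylProb μ (n + 1) x := by
  rw [h.cylProb_eq, markovWeight_succ, markovWeight_zero, ← cylProb_mul_transProb, Nat.cast_zero,
    slide_zero]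

theorem blockH_succ_sub (h : IsMarkovApprox n μ ν) (M : ℕ) :
    blockH ν (n + M + 1) - blockH ν (n + M) = ∫ x, -Real.log (transProb μ n x) ∂ν := by
  have := h.isProb
  have h1 := integral_eq_sum ν (n + M + 1) (f := fun x => -Real.log (cylProb ν (n + M + 1) x))
    fun x y h => by rw [cylProb_congr ν h]
  have h2 := integral_eq_sum ν (n + M + 1) (f := fun x => -Real.log (cylProb ν (n + M) x))
    fun x y h => by rw [cylProb_congr ν (word_mono (by omega) h)]
  rw [blockH_eq_integral, blockH_eq_integral, ← integral_sub h1.1 h2.1]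
  trans ∫ x, -Real.log (transProb μ n (slide M x)) ∂ν
  · refine integral_congr_ae ?_
    filter_upwards [ae_cylProb_pos ν (n + M + 1)] with x hx
    have h3 : cylProb ν (n + M + 1) x = cylProb ν (n + M) x * transProb μ n (slide M x) := by
      rw [h.cylProb_eq, add_assoc, h.cylProb_eq, markovWeight_succ]
    rw [h3] at hx
    have h4 := pos_of_mul_pos_left hx (transProb_nonneg _ _ _)
    have h5 := pos_of_mul_pos_right hx (cylProb_nonneg _ _ _)
    rw [h3, Real.log_mul h4.ne' h5.ne']
    ring
  · exact integral_slide h.invariant M fun x => -Real.log (transProb μ n x)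

theorem mEntropy_eq [IsProbabilityMeasure μ] (h : IsMarkovApprox n μ ν) :
    mEntropy ν = blockH μ (n + 1) - blockH μ n := by
  have := h.isProb
  have h1 : blockH μ (n + 1) - blockH μ n = ∫ x, -Real.log (transProb μ n x) ∂ν := by
    rw [← h.blockH_succ_sub 0, add_zero]
    simp_rw [blockH_eq_sum, ← cylProb_extendWord, h.cylProb_eq_self, h.cylProb_eq_succ]
  have h2 : ∀ j, n ≤ j → blockH ν (j + 1) - blockH ν j = blockH μ (n + 1) - blockH μ n := by
    intro j hj
    obtain ⟨M, rfl⟩ := Nat.exists_eq_add_of_le hj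
    rw [h.blockH_succ_sub, h1]
  exact le_antisymm (mEntropy_le_of_forall_sub_le fun j hj => (h2 j hj).le)
    (le_mEntropy_of_forall_le_sub h.invariant fun j hj => (h2 j hj).ge)

end IsMarkovApprox

end Entropy

section Ergodicity

variable {k n : ℕ} {μ ν : Measure (ℤ → Fin k)}

namespace IsMarkovApprox

theorem cylProb_mul_cylProb (h : IsMarkovApprox n μ ν) (M : ℕ) (x : ℤ → Fin k) :
    cylProb ν (n + (M + M)) (slide (-M) x) * cylProb ν n x =
      cylProb ν (n + M) (slide (-M) x) * cylProb ν (n + M) x := by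
  rw [h.cylProb_eq, h.cylProb_eq, h.cylProb_eq, ← add_zero n, h.cylProb_eq, add_zero]
  simp only [markovWeight, Finset.prod_range_add, slide_slide, Finset.range_zero,
    Finset.prod_empty, mul_one]
  have : ∀ i : ℕ, ((M + i : ℕ) : ℤ) + -M = i := fun i => by push_cast; ring
  simp_rw [this]
  ring

/-- Conditionally on the letters at positions `0, …, n - 1`, the past and the future are
independent. -/
theorem measureReal_inter_mul (h : IsMarkovApprox n μ ν) (M : ℕ)
    (D E : Set (Fin (n + M) → Fin k)) (u : Fin n → Fin k) :
    ν.real (((fun x => word (n + M) (slide (-M) x)) ⁻¹' D ∩ word (n + M) ⁻¹' E) ∩ word n ⁻¹' {u}) *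
        ν.real (word n ⁻¹' {u}) =
      ν.real ((fun x => word (n + M) (slide (-M) x)) ⁻¹' D ∩ word n ⁻¹' {u}) *
        ν.real (word (n + M) ⁻¹' E ∩ word n ⁻¹' {u}) := by
  have := h.isProb
  set U : Set (ℤ → Fin k) := word n ⁻¹' {u} with hU
  set past : (ℤ → Fin k) → Fin (n + M) → Fin k := fun x => word (n + M) (slide (-M) x) with hpast
  have hpm : Measurable past := (measurable_word _).comp (measurable_slide _)
  have hfm : Measurable (word (n + M) : (ℤ → Fin k) → _) := measurable_word _
  have hdisc : ∀ D : Set (Fin (n + M) → Fin k), MeasurableSet D := fun D => D.toFinite.measurableSet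
  have key : ν U • (ν.restrict U).map (fun x => (past x, word (n + M) x)) =
      ((ν.restrict U).map past).prod ((ν.restrict U).map (word (n + M))) := by
    refine Measure.ext_of_singleton fun ⟨p, f⟩ => ?_
    rw [← Set.singleton_prod_singleton, Measure.prod_prod, Measure.smul_apply,
      Measure.map_apply (hpm.prodMk hfm) ((hdisc _).prod (hdisc _)),
      Measure.map_apply hpm (hdisc _), Measure.map_apply hfm (hdisc _),
      Measure.restrict_apply ((hpm.prodMk hfm) ((hdisc _).prod (hdisc _))),
      Measure.restrict_apply (hpm (hdisc _)), Measure.restrict_apply (hfm (hdisc _)), smul_eq_mul,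
      Set.mk_preimage_prod]
    rcases ((past ⁻¹' {p} ∩ word (n + M) ⁻¹' {f}) ∩ U).eq_empty_or_nonempty with he | ⟨x, hx⟩
    · rw [he, measure_empty, mul_zero]
      rcases (past ⁻¹' {p} ∩ U).eq_empty_or_nonempty with he1 | ⟨y, hyp, hyU⟩
      · rw [he1, measure_empty, zero_mul]
      rcases (word (n + M) ⁻¹' {f} ∩ U).eq_empty_or_nonempty with he2 | ⟨z, hzf, hzU⟩
      · rw [he2, measure_empty, mul_zero]
      exfalso
      have hyz : word n y = word n z := hyU.trans hzU.symm
      rw [word_eq_iff] at hyz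
      have hx : (fun i : ℤ => if i < n then y i else z i) ∈
          ((past ⁻¹' {p} ∩ word (n + M) ⁻¹' {f}) ∩ U) := by
        refine ⟨⟨?_, ?_⟩, ?_⟩
        · rw [Set.mem_preimage, Set.mem_singleton_iff, ← hyp, hpast]
          refine word_eq_iff.2 fun i h0 h1 => ?_
          simp only [slide]
          rw [if_pos (by omega)]
        · rw [Set.mem_preimage, Set.mem_singleton_iff, ← hzf]
          refine word_eq_iff.2 fun i h0 h1 => ?_
          split_ifs with hi
          · exact hyz i h0 hi
          · rfl
        · rw [hU, Set.mem_preimage, Set.mem_singleton_iff, ← hyU]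
          refine word_eq_iff.2 fun i h0 h1 => ?_
          rw [if_pos (by omega)]
      rw [he] at hx
      exact hx
    · obtain ⟨⟨hxp, hxf⟩, hxU⟩ := hx
      simp only [Set.mem_preimage, Set.mem_singleton_iff, hU] at hxp hxf hxU
      have e1 : (past ⁻¹' {p} ∩ word (n + M) ⁻¹' {f}) ∩ U =
          slide (-M) ⁻¹' (word (n + (M + M)) ⁻¹' {word (n + (M + M)) (slide (-M) x)}) := by
        ext y
        simp only [hU, Set.mem_inter_iff, Set.mem_preimage, Set.mem_singleton_iff, ← hxp, ← hxf,
          ← hxU, hpast, word_eq_iff, slide]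
        constructor
        · rintro ⟨⟨h1, h2⟩, h3⟩ i h0 hi
          by_cases hiM : i < n + M
          · exact h1 i h0 (by omega)
          · exact h2 _ (by omega) (by omega)
        · refine fun h1 => ⟨⟨fun i h0 hi => h1 i h0 (by omega), fun i h0 hi => ?_⟩,
            fun i h0 hi => ?_⟩
          · simpa using h1 (i + M) (by omega) (by omega)
          · simpa using h1 (i + M) (by omega) (by omega)
      have e2 : past ⁻¹' {p} ∩ U =
          slide (-M) ⁻¹' (word (n + M) ⁻¹' {word (n + M) (slide (-M) x)}) := by
        ext y
        simp only [hU, Set.mem_inter_iff, Set.mem_preimage, Set.mem_singleton_iff, ← hxp,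
          ← hxU, hpast, word_eq_iff, slide]
        refine ⟨fun h1 => h1.1, fun h1 => ⟨h1, fun i h0 hi => ?_⟩⟩
        simpa using h1 (i + M) (by omega) (by omega)
      have e3 : word (n + M) ⁻¹' {f} ∩ U = word (n + M) ⁻¹' {word (n + M) x} := by
        ext y
        simp only [hU, Set.mem_inter_iff, Set.mem_preimage, Set.mem_singleton_iff, ← hxf,
          ← hxU]
        exact ⟨fun h1 => h1.1, fun h1 => ⟨h1, word_mono (by omega) h1⟩⟩
      rw [e1, e2, e3, (measurePreserving_slide h.invariant _).measure_preimage
        (measurableSet_word _ _).nullMeasurableSet,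
        (measurePreserving_slide h.invariant _).measure_preimage
        (measurableSet_word _ _).nullMeasurableSet, hU, ← hxU,
        ← ENNReal.toReal_eq_toReal_iff' (by finiteness) (by finiteness), ENNReal.toReal_mul,
        ENNReal.toReal_mul, mul_comm]
      exact h.cylProb_mul_cylProb M x
  have := congrArg (fun m => (m (D ×ˢ E)).toReal) key
  rw [Measure.prod_prod, Measure.smul_apply,
      Measure.map_apply (hpm.prodMk hfm) ((hdisc _).prod (hdisc _)),
      Measure.map_apply hpm (hdisc _), Measure.map_apply hfm (hdisc _),
      Measure.restrict_apply ((hpm.prodMk hfm) ((hdisc _).prod (hdisc _))),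
      Measure.restrict_apply (hpm (hdisc _)), Measure.restrict_apply (hfm (hdisc _)), smul_eq_mul,
      Set.mk_preimage_prod, ENNReal.toReal_mul, ENNReal.toReal_mul, mul_comm] at this
  exact this

end IsMarkovApprox

theorem exists_measureReal_symmDiff_lt [IsFiniteMeasure ν] {B : Set (ℤ → Fin k)}
    (hB : MeasurableSet B) {ε : ℝ} (hε : 0 < ε) :
    ∃ C ∈ measurableCylinders fun _ : ℤ => Fin k, ν.real (symmDiff B C) < ε := by
  obtain ⟨C, hC, h⟩ := (Measure.MeasureDense.of_generateFrom_isSetAlgebra_finite ν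
    isSetAlgebra_measurableCylinders generateFrom_measurableCylinders.symm).approx B hB
      (by finiteness) ε hε
  exact ⟨C, hC, ENNReal.toReal_lt_of_lt_ofReal h⟩

theorem preimage_slide_eq {B : Set (ℤ → Fin k)} (h : slide 1 ⁻¹' B = B) (a : ℤ) :
    slide a ⁻¹' B = B := by
  induction a using Int.induction_on with
  | zero => ext x; simp [slide_zero]
  | succ a ih =>
    ext x
    conv_rhs => rw [← ih, ← h]
    simp [slide_slide, add_comm]
  | pred a ih =>
    have h1 : slide (-a - 1) ⁻¹' (slide 1 ⁻¹' B) = slide (-a) ⁻¹' B := by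
      ext x
      simp [slide_slide]
    rw [h] at h1
    exact h1.trans ih

theorem abs_measureReal_inter_sub_le [IsFiniteMeasure ν] (B C U : Set (ℤ → Fin k)) :
    |ν.real (B ∩ U) - ν.real (C ∩ U)| ≤ ν.real (symmDiff B C) := by
  have key : ∀ B C : Set (ℤ → Fin k),
      ν.real (B ∩ U) - ν.real (C ∩ U) ≤ ν.real (symmDiff B C) := by
    intro B C
    rw [sub_le_iff_le_add]
    refine (measureReal_mono ?_).trans (measureReal_union_le _ _)
    rintro x ⟨hB, hU⟩
    by_cases hC : x ∈ C
    · exact Or.inr ⟨hC, hU⟩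
    · exact Or.inl (Or.inl ⟨hB, hC⟩)
  rw [abs_le]
  constructor
  · have := key C B
    rw [symmDiff_comm] at this
    linarith
  · exact key B C

namespace IsMarkovApprox

theorem measureReal_inter_eq [NeZero k] (h : IsMarkovApprox n μ ν) {B : Set (ℤ → Fin k)}
    (hB : MeasurableSet B) (hinv : slide 1 ⁻¹' B = B) (u : Fin n → Fin k) :
    ν.real (B ∩ word n ⁻¹' {u}) = 0 ∨
      ν.real (B ∩ word n ⁻¹' {u}) = ν.real (word n ⁻¹' {u}) := by
  have := h.isProb
  set U : Set (ℤ → Fin k) := word n ⁻¹' {u} with hU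
  have key : |ν.real (B ∩ U) * (ν.real U - ν.real (B ∩ U))| ≤ 0 := by
    refine le_of_forall_pos_le_add fun ε hε => ?_
    obtain ⟨C, hC, hBC⟩ := exists_measureReal_symmDiff_lt (ν := ν) hB (ε := ε / 4) (by positivity)
    obtain ⟨R, hnR, D, rfl⟩ := exists_eq_preimage_word hC n
    obtain ⟨M, hM⟩ := Nat.exists_eq_add_of_le (show n ≤ 2 * R by omega)
    obtain ⟨D', hD⟩ : ∃ D' : Set (Fin (n + M) → Fin k),
        word (2 * R) ⁻¹' D = (word (n + M) : (ℤ → Fin k) → _) ⁻¹' D' := hM ▸ ⟨D, rfl⟩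
    rw [hD] at hBC
    set W : Set (ℤ → Fin k) := word (n + M) ⁻¹' D' with hW
    have hsymm : ∀ a : ℤ, ν.real (symmDiff B (slide a ⁻¹' W)) = ν.real (symmDiff B W) := by
      intro a
      rw [← (measurePreserving_slide h.invariant a).measureReal_preimage
        (hB.symmDiff (measurableSet_word _ D')).nullMeasurableSet, Set.preimage_symmDiff,
        preimage_slide_eq hinv]
    rw [hsymm] at hBC
    have hind := h.measureReal_inter_mul M D' D' u
    have h1 := abs_measureReal_inter_sub_le (ν := ν) B (slide (-M) ⁻¹' W) U
    have h2 := abs_measureReal_inter_sub_le (ν := ν) B W U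
    have h3 := abs_measureReal_inter_sub_le (ν := ν) B (slide (-M) ⁻¹' W ∩ W) U
    have h4 : ν.real (symmDiff B (slide (-M) ⁻¹' W ∩ W)) ≤ ε / 2 := by
      refine (measureReal_mono (s₂ := symmDiff B (slide (-M) ⁻¹' W) ∪ symmDiff B W) ?_).trans
        ((measureReal_union_le _ _).trans ?_)
      · intro x
        simp only [Set.mem_symmDiff, Set.mem_union, Set.mem_inter_iff]
        tauto
      · rw [hsymm]; linarith
    rw [hsymm] at h1
    rw [← hU] at hind
    change ν.real ((slide (-M) ⁻¹' W ∩ W) ∩ U) * ν.real U =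
      ν.real (slide (-M) ⁻¹' W ∩ U) * ν.real (W ∩ U) at hind
    have hb := measureReal_le_one (μ := ν) (s := B ∩ U)
    have hu := measureReal_le_one (μ := ν) (s := U)
    have hp := measureReal_le_one (μ := ν) (s := slide (-M) ⁻¹' W ∩ U)
    have hb0 := measureReal_nonneg (μ := ν) (s := B ∩ U)
    have hu0 := measureReal_nonneg (μ := ν) (s := U)
    have hp0 := measureReal_nonneg (μ := ν) (s := slide (-M) ⁻¹' W ∩ U)
    generalize ν.real (B ∩ U) = b at *
    generalize ν.real U = v at *
    generalize ν.real (slide (-M) ⁻¹' W ∩ U) = p at *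
    generalize ν.real (W ∩ U) = f at *
    generalize ν.real ((slide (-M) ⁻¹' W ∩ W) ∩ U) = q at *
    rw [show b * (v - b) = (b - q) * v + (p * (b - f) * -1 + b * (b - p) * -1) by
      linear_combination hind]
    have habs : ∀ {c t e : ℝ}, 0 ≤ t → t ≤ 1 → |c| ≤ e → |c * t| ≤ e := by
      intro c t e h0 h1 hc
      rw [abs_mul, abs_of_nonneg h0]
      exact (mul_le_of_le_one_right (abs_nonneg c) h1).trans hc
    have a1 := habs hu0 hu (h3.trans h4)
    have a2 := habs hp0 hp (h2.trans hBC.le)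
    have a3 := habs hb0 hb (h1.trans hBC.le)
    rw [abs_le] at *
    constructor <;> linarith
  rw [abs_nonpos_iff, mul_eq_zero, sub_eq_zero] at key
  exact key.imp id Eq.symm

theorem ergodic [NeZero k] (h : IsMarkovApprox n μ ν)
    (hconn : ∀ x y, 0 < cylProb ν n x → 0 < cylProb ν n y → ∃ R : ℕ,
      0 < ν.real (word n ⁻¹' {word n x} ∩ slide R ⁻¹' (word n ⁻¹' {word n y}))) :
    Ergodic (slide 1) ν := by
  have := h.isProb
  refine ⟨h.invariant, ⟨fun B hB hinv => ?_⟩⟩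
  have hcyl : ∀ B : Set (ℤ → Fin k), ν B ≠ 0 → ∃ x, ν.real (B ∩ word n ⁻¹' {word n x}) ≠ 0 := by
    intro B hB
    by_contra! h0
    refine hB (measure_mono_null (t := ⋃ w : Fin n → Fin k, B ∩ word n ⁻¹' {w})
      (fun x hx => Set.mem_iUnion.2 ⟨word n x, hx, rfl⟩) (measure_iUnion_null fun w => ?_))
    have := h0 (extendWord n w)
    rwa [word_extendWord, measureReal_eq_zero_iff] at this
  rw [eventuallyConst_set']
  by_contra! hne
  obtain ⟨x, hx⟩ := hcyl B fun h0 => hne.1 (ae_eq_empty.2 h0)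
  obtain ⟨y, hy⟩ := hcyl Bᶜ fun h0 => hne.2 (ae_eq_univ.2 h0)
  have hx1 := (h.measureReal_inter_eq hB hinv (word n x)).resolve_left hx
  have hy1 := (h.measureReal_inter_eq hB.compl (by rw [Set.preimage_compl, hinv])
    (word n y)).resolve_left hy
  have hx2 : ν (word n ⁻¹' {word n x} \ B) = 0 := by
    have := measureReal_inter_add_sdiff (μ := ν) (s := word n ⁻¹' {word n x}) hB
    rw [Set.inter_comm, hx1, add_eq_left, measureReal_eq_zero_iff] at this
    exact this
  have hy2 : ν (word n ⁻¹' {word n y} \ Bᶜ) = 0 := by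
    have := measureReal_inter_add_sdiff (μ := ν) (s := word n ⁻¹' {word n y}) hB.compl
    rw [Set.inter_comm, hy1, add_eq_left, measureReal_eq_zero_iff] at this
    exact this
  obtain ⟨R, hR⟩ := hconn x y
    ((measureReal_nonneg.lt_of_ne hx.symm).trans_le (measureReal_mono Set.inter_subset_right))
    ((measureReal_nonneg.lt_of_ne hy.symm).trans_le (measureReal_mono Set.inter_subset_right))
  refine hR.ne' ((measureReal_eq_zero_iff).2 (measure_mono_null
    (t := (word n ⁻¹' {word n x} \ B) ∪ slide R ⁻¹' (word n ⁻¹' {word n y} \ Bᶜ)) ?_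
    (measure_union_null hx2 ?_)))
  · rintro z ⟨h1, h2⟩
    by_cases hz : z ∈ B
    · refine Or.inr ⟨h2, fun h3 => h3 ?_⟩
      rw [← preimage_slide_eq hinv R] at hz
      exact hz
    · exact Or.inl ⟨h1, hz⟩
  · rw [(measurePreserving_slide h.invariant R).measure_preimage
      ((measurableSet_word _ _).diff hB.compl).nullMeasurableSet, hy2]

end IsMarkovApprox

end Ergodicity

section Subshift

variable {k : ℕ} {A : Fin k → Fin k → ℕ}

theorem exists_path_of_matPow_pos (h01 : ∀ i j, A i j = 0 ∨ A i j = 1) {m : ℕ} {i j : Fin k}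
    (h : 0 < matPow A m i j) :
    ∃ w : ℤ → Fin k, w 0 = i ∧ w m = j ∧ ∀ l : ℤ, 0 ≤ l → l < m → A (w l) (w (l + 1)) = 1 := by
  induction m generalizing j with
  | zero =>
    simp only [matPow] at h
    split_ifs at h with hij
    · exact ⟨fun _ => i, rfl, hij, fun l h0 h1 => by simp at h1; omega⟩
    · omega
  | succ m ih =>
    rw [matPow] at h
    obtain ⟨r, -, hr⟩ := Finset.exists_ne_zero_of_sum_ne_zero h.ne'
    obtain ⟨w, h0, h1, hw⟩ := ih (Nat.pos_of_ne_zero (left_ne_zero_of_mul hr))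
    have hA := (h01 r j).resolve_left (right_ne_zero_of_mul hr)
    refine ⟨fun l => if l ≤ m then w l else j, ?_, ?_, fun l hl0 hl1 => ?_⟩
    · beta_reduce
      rw [if_pos (by omega), h0]
    · beta_reduce
      rw [if_neg (by push_cast; omega)]
    · push_cast at hl1
      beta_reduce
      by_cases hl : l < m
      · rw [if_pos (by omega), if_pos (by omega)]
        exact hw l hl0 hl
      · obtain rfl : l = m := by omega
        rw [if_pos le_rfl, if_neg (by omega), h1, hA]

theorem exists_path (h01 : ∀ i j, A i j = 0 ∨ A i j = 1) (hirr : IrreducibleMat A) (i j : Fin k) :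
    ∃ m : ℕ, 1 ≤ m ∧ ∃ w : ℤ → Fin k, w 0 = i ∧ w m = j ∧
      ∀ l : ℤ, 0 ≤ l → l < m → A (w l) (w (l + 1)) = 1 := by
  obtain ⟨m, hm, h⟩ := hirr i j
  exact ⟨m, hm, exists_path_of_matPow_pos h01 h⟩

theorem slide_mem_SFT {x : ℤ → Fin k} (hx : x ∈ SFT A) (a : ℤ) : slide a x ∈ SFT A := by
  intro i
  have := hx (i + a)
  rwa [add_right_comm] at this

/-- Any two words occurring in an irreducible subshift of finite type can be read one after the
other in a point of the subshift. -/
theorem exists_glue (h01 : ∀ i j, A i j = 0 ∨ A i j = 1) (hirr : IrreducibleMat A)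
    {x y : ℤ → Fin k} (hx : x ∈ SFT A) (hy : y ∈ SFT A) (n : ℕ) :
    ∃ z ∈ SFT A, ∃ R : ℕ, word n z = word n x ∧ word n (slide R z) = word n y := by
  obtain ⟨m, hm, w, h0, h1, hw⟩ := exists_path h01 hirr (x n) (y 0)
  refine ⟨fun i => if i ≤ n then x i else if i ≤ n + m then w (i - n) else y (i - (n + m)), ?_,
    n + m, ?_, ?_⟩
  · intro i
    beta_reduce
    rcases lt_trichotomy i n with hi | rfl | hi
    · rw [if_pos hi.le, if_pos (by omega)]
      exact hx i
    · rw [if_pos le_rfl, if_neg (by omega), if_pos (by omega)]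
      have := hw 0 le_rfl (by omega)
      rw [h0] at this
      rwa [add_sub_cancel_left]
    · rw [if_neg (by omega)]
      rcases lt_trichotomy i (n + m) with hi' | rfl | hi'
      · rw [if_pos (by omega), if_neg (by omega), if_pos (by omega), add_sub_right_comm]
        exact hw _ (by omega) (by omega)
      · rw [if_pos le_rfl, if_neg (by omega), if_neg (by omega), add_sub_cancel_left, h1,
          add_sub_cancel_left]
        exact hy 0
      · rw [if_neg (by omega), if_neg (by omega), if_neg (by omega), add_sub_right_comm]
        exact hy _
  · refine word_eq_iff.2 fun i hi0 hi1 => ?_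
    rw [if_pos hi1.le]
  · refine word_eq_iff.2 fun i hi0 hi1 => ?_
    simp only [slide]
    push_cast
    rw [if_neg (by omega)]
    split_ifs with hi
    · obtain rfl : i = 0 := by omega
      rw [zero_add, add_sub_cancel_left, h1]
    · rw [add_sub_cancel_right]

theorem exists_periodic (h01 : ∀ i j, A i j = 0 ∨ A i j = 1) (hirr : IrreducibleMat A)
    {x : ℤ → Fin k} (hx : x ∈ SFT A) (n : ℕ) :
    ∃ z ∈ SFT A, ∃ p : ℕ, 1 ≤ p ∧ slide p z = z ∧ word n z = word n x := by
  obtain ⟨m, hm, w, h0, h1, hw⟩ := exists_path h01 hirr (x n) (x 0)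
  set v : ℤ → Fin k := fun i => if i ≤ n then x i else w (i - n) with hv
  have hstep : ∀ i : ℤ, 0 ≤ i → i < n + m → A (v i) (v (i + 1)) = 1 := by
    intro i hi0 hi1
    simp only [hv]
    rcases lt_trichotomy i n with hi | rfl | hi
    · rw [if_pos hi.le, if_pos (by omega)]
      exact hx i
    · rw [if_pos le_rfl, if_neg (by omega)]
      have := hw 0 le_rfl (by omega)
      rw [h0] at this
      rwa [add_sub_cancel_left]
    · rw [if_neg (by omega), if_neg (by omega), add_sub_right_comm]
      exact hw _ (by omega) (by omega)
  have hend : v (n + m) = v 0 := by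
    simp only [hv]
    rw [if_neg (by omega), if_pos (by omega), add_sub_cancel_left, h1]
  have hp : (0 : ℤ) < n + m := by omega
  refine ⟨fun i => v (i % (n + m)), fun i => ?_, n + m, by omega, ?_, ?_⟩
  · beta_reduce
    have hmod := Int.emod_nonneg i hp.ne'
    have hlt := Int.emod_lt_of_pos i hp
    have hnext : v ((i + 1) % (n + m)) = v (i % (n + m) + 1) := by
      rw [← Int.emod_add_emod]
      rcases (show i % (n + m) + 1 ≤ n + m by omega).lt_or_eq with h | h
      · rw [Int.emod_eq_of_lt (by omega) h]
      · rw [h, Int.emod_self, hend]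
    rw [hnext]
    exact hstep _ hmod hlt
  · funext i
    simp [slide]
  · refine word_eq_iff.2 fun i hi0 hi1 => ?_
    rw [Int.emod_eq_of_lt hi0 (by omega)]
    simp only [hv]
    rw [if_pos hi1.le]

theorem measurableSet_SFT : MeasurableSet (SFT A) := by
  have : SFT A = ⋂ i : ℤ, (fun x : ℤ → Fin k => (x i, x (i + 1))) ⁻¹' {q | A q.1 q.2 = 1} := by
    ext x; simp [SFT]
  rw [this]
  exact MeasurableSet.iInter fun i => ((measurable_pi_apply i).prodMk (measurable_pi_apply _))
    (Set.toFinite _).measurableSet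

theorem isClosed_SFT : IsClosed (SFT A) := by
  have : SFT A = ⋂ i : ℤ, (fun x : ℤ → Fin k => (x i, x (i + 1))) ⁻¹' {q | A q.1 q.2 = 1} := by
    ext x; simp [SFT]
  rw [this]
  exact isClosed_iInter fun i => (isClosed_discrete _).preimage
    ((continuous_apply i).prodMk (continuous_apply _))

theorem InvProbOn.ae_mem {μ : Measure (ℤ → Fin k)} (h : InvProbOn A μ) : ∀ᵐ x ∂μ, x ∈ SFT A := by
  have := h.1
  exact (mem_ae_iff_prob_eq_one measurableSet_SFT).2 h.2.2

theorem InvProbOn.invariant {μ : Measure (ℤ → Fin k)} (h : InvProbOn A μ) :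
    MeasurePreserving (slide 1) μ μ := h.2.1

/-- The mixture `(1 - t) μ + t ν`. -/
noncomputable def mix (t : ℝ) (μ ν : Measure (ℤ → Fin k)) : Measure (ℤ → Fin k) :=
  ENNReal.ofReal (1 - t) • μ + ENNReal.ofReal t • ν

theorem measureReal_mix {t : ℝ} (h0 : 0 ≤ t) (h1 : t ≤ 1) (μ ν : Measure (ℤ → Fin k))
    [IsFiniteMeasure μ] [IsFiniteMeasure ν] (s : Set (ℤ → Fin k)) :
    (mix t μ ν).real s = (1 - t) * μ.real s + t * ν.real s := by
  rw [Measure.real, mix, Measure.add_apply, Measure.smul_apply, Measure.smul_apply, smul_eq_mul,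
    smul_eq_mul, ENNReal.toReal_add (by finiteness) (by finiteness), ENNReal.toReal_mul,
    ENNReal.toReal_mul, ENNReal.toReal_ofReal h0, ENNReal.toReal_ofReal (by linarith)]
  rfl

theorem integral_mix {t : ℝ} (h0 : 0 ≤ t) (h1 : t ≤ 1) {μ ν : Measure (ℤ → Fin k)}
    {f : (ℤ → Fin k) → ℝ} (hμ : Integrable f μ) (hν : Integrable f ν) :
    ∫ x, f x ∂(mix t μ ν) = (1 - t) * ∫ x, f x ∂μ + t * ∫ x, f x ∂ν := by
  rw [mix, integral_add_measure (hμ.smul_measure ENNReal.ofReal_ne_top)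
    (hν.smul_measure ENNReal.ofReal_ne_top), integral_smul_measure, integral_smul_measure,
    ENNReal.toReal_ofReal h0, ENNReal.toReal_ofReal (by linarith)]
  rfl

theorem InvProbOn.mix {t : ℝ} (h0 : 0 ≤ t) (h1 : t ≤ 1) {μ ν : Measure (ℤ → Fin k)}
    (hμ : InvProbOn A μ) (hν : InvProbOn A ν) : InvProbOn A (mix t μ ν) := by
  have hsum : ENNReal.ofReal (1 - t) + ENNReal.ofReal t = 1 := by
    rw [← ENNReal.ofReal_add (by linarith) h0]; simp
  have := hμ.1
  have := hν.1
  refine ⟨⟨?_⟩, ⟨measurable_slide 1, ?_⟩, ?_⟩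
  · simp [_root_.mix, hsum]
  · change Measure.map (slide 1) _ = _
    rw [_root_.mix, Measure.map_add _ _ (measurable_slide 1), Measure.map_smul, Measure.map_smul,
      hμ.invariant.map_eq, hν.invariant.map_eq]
  · simp [_root_.mix, hsum, hμ.2.2, hν.2.2]

/-- The invariant measure carried by the orbit of a point `z` of period `p`. -/
noncomputable def orbitMeasure (z : ℤ → Fin k) (p : ℕ) : Measure (ℤ → Fin k) :=
  (p : ENNReal)⁻¹ • ∑ i ∈ Finset.range p, Measure.dirac (slide i z)

theorem invProbOn_orbitMeasure {z : ℤ → Fin k} (hz : z ∈ SFT A) {p : ℕ} (hp : 1 ≤ p)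
    (hpz : slide p z = z) : InvProbOn A (orbitMeasure z p) := by
  have hp0 : (p : ENNReal) ≠ 0 := by simp; omega
  refine ⟨⟨?_⟩, ⟨measurable_slide 1, ?_⟩, ?_⟩
  · simp [orbitMeasure, ENNReal.inv_mul_cancel hp0]
  · rw [orbitMeasure, Measure.map_smul]
    congr 1
    have : ∀ s : Finset ℕ, (∑ i ∈ s, Measure.dirac (slide i z)).map (slide 1) =
        ∑ i ∈ s, Measure.dirac (slide ((i + 1 : ℕ) : ℤ) z) := by
      intro s
      classical
      induction s using Finset.induction_on with
      | empty => simp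
      | insert i s hi ih =>
        rw [Finset.sum_insert hi, Finset.sum_insert hi, Measure.map_add _ _ (measurable_slide 1),
          ih, Measure.map_dirac' (measurable_slide 1), slide_slide]
        congr 3
        push_cast; ring
    change Measure.map (slide 1) _ = _
    rw [this]
    obtain ⟨q, rfl⟩ := Nat.exists_eq_add_of_le' hp
    rw [Finset.sum_range_succ, hpz, Finset.sum_range_succ', Nat.cast_zero, slide_zero]
  · simp [orbitMeasure, Measure.dirac_apply' _ measurableSet_SFT, slide_mem_SFT hz,
      ENNReal.inv_mul_cancel hp0]

theorem ae_orbitMeasure {z : ℤ → Fin k} {p : ℕ} (hpz : slide p z = z) :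
    ∀ᵐ x ∂(orbitMeasure z p), slide p x = x := by
  refine Measure.ae_smul_measure ?_ _
  have : ∀ s : Finset ℕ, ∀ᵐ x ∂(∑ i ∈ s, Measure.dirac (slide i z)), slide p x = x := by
    intro s
    classical
    induction s using Finset.induction_on with
    | empty => simp
    | insert i s hi ih =>
      rw [Finset.sum_insert hi, ae_add_measure_iff]
      refine ⟨(ae_dirac_iff ?_).2 ?_, ih⟩
      · exact measurableSet_eq_fun (measurable_slide p) measurable_id
      · rw [slide_slide, add_comm, ← slide_slide, hpz]
  exact this _

theorem cylProb_orbitMeasure_pos {z : ℤ → Fin k} {p : ℕ} (hp : 1 ≤ p) (n : ℕ) :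
    0 < cylProb (orbitMeasure z p) n z := by
  rw [cylProb, orbitMeasure, measureReal_ennreal_smul_apply]
  refine mul_pos ?_ (ENNReal.toReal_pos ?_ (by finiteness))
  · rw [ENNReal.toReal_inv]
    simp
    omega
  · rw [Measure.finsetSum_apply]
    refine (lt_of_lt_of_le ?_ (Finset.single_le_sum (fun i _ => zero_le)
      (Finset.mem_range.2 hp))).ne'
    simp [Measure.dirac_apply' _ (measurableSet_word n _), slide_zero]

theorem blockH_succ_eq_of_periodic [NeZero k] {μ : Measure (ℤ → Fin k)} [IsFiniteMeasure μ] {p : ℕ}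
    (hp : 1 ≤ p) (h : ∀ᵐ x ∂μ, slide p x = x) {n : ℕ} (hn : p ≤ n) :
    blockH μ (n + 1) = blockH μ n := by
  rw [blockH_eq_integral, blockH_eq_integral]
  refine integral_congr_ae ?_
  filter_upwards [h] with x hx
  congr 2
  refine measureReal_congr ?_
  filter_upwards [h] with y hy
  refine propext ⟨fun h1 => word_mono (Nat.le_succ n) h1, fun h1 => ?_⟩
  change word n y = word n x at h1
  change word (n + 1) y = word (n + 1) x
  rw [word_eq_iff] at *
  intro i h0 hi
  by_cases hin : i < n
  · exact h1 i h0 hin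
  · have hx' := congrFun hx (i - p)
    have hy' := congrFun hy (i - p)
    simp only [slide, sub_add_cancel] at hx' hy'
    rw [hx', hy']
    exact h1 _ (by omega) (by omega)

/-- An irreducible subshift of finite type carries an invariant measure charging every word of a
given length. -/
theorem exists_invProbOn_cylProb_pos (h01 : ∀ i j, A i j = 0 ∨ A i j = 1) (hirr : IrreducibleMat A)
    (hne : (SFT A).Nonempty) (n : ℕ) :
    ∃ ρ : Measure (ℤ → Fin k), InvProbOn A ρ ∧ ∀ x ∈ SFT A, 0 < cylProb ρ n x := by
  have horb : ∀ x ∈ SFT A, ∃ ρ : Measure (ℤ → Fin k), InvProbOn A ρ ∧ 0 < cylProb ρ n x := by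
    intro x hx
    obtain ⟨z, hz, p, hp, hpz, hw⟩ := exists_periodic h01 hirr hx n
    refine ⟨_, invProbOn_orbitMeasure hz hp hpz, ?_⟩
    rw [← cylProb_congr _ hw]
    exact cylProb_orbitMeasure_pos hp n
  have key : ∀ s : Finset (Fin n → Fin k), ∃ ρ : Measure (ℤ → Fin k), InvProbOn A ρ ∧
      ∀ x ∈ SFT A, word n x ∈ s → 0 < cylProb ρ n x := by
    intro s
    classical
    induction s using Finset.induction_on with
    | empty =>
      obtain ⟨x, hx⟩ := hne
      obtain ⟨ρ, hρ, -⟩ := horb x hx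
      exact ⟨ρ, hρ, by simp⟩
    | insert w s hw ih =>
      obtain ⟨ρ, hρ, h⟩ := ih
      by_cases hex : ∃ x ∈ SFT A, word n x = w
      · obtain ⟨x, hx, rfl⟩ := hex
        obtain ⟨ρ', hρ', h'⟩ := horb x hx
        have := hρ.1
        have := hρ'.1
        refine ⟨mix (1 / 2) ρ ρ', hρ.mix (by norm_num) (by norm_num) hρ', fun y hy hys => ?_⟩
        rw [cylProb, measureReal_mix (by norm_num) (by norm_num)]
        change 0 < (1 - 1 / 2) * cylProb ρ n y + 1 / 2 * cylProb ρ' n y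
        have h0 := cylProb_nonneg ρ n y
        have h0' := cylProb_nonneg ρ' n y
        rcases Finset.mem_insert.1 hys with hyx | hys
        · rw [cylProb_congr ρ' hyx] at *
          linarith
        · linarith [h y hy hys]
      · refine ⟨ρ, hρ, fun y hy hys => h y hy ?_⟩
        rcases Finset.mem_insert.1 hys with hyx | hys
        · exact absurd ⟨y, hy, hyx⟩ hex
        · exact hys
  obtain ⟨ρ, hρ, h⟩ := key Finset.univ
  exact ⟨ρ, hρ, fun x hx => h x hx (Finset.mem_univ _)⟩

end Subshift

section SubshiftMarkov

variable {k n : ℕ} {A : Fin k → Fin k → ℕ} {μ ν : Measure (ℤ → Fin k)}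

theorem InvProbOn.exists_mem_word_eq (hμ : InvProbOn A μ) {j : ℕ} {x : ℤ → Fin k}
    (hx : 0 < cylProb μ j x) : ∃ y ∈ SFT A, word j y = word j x := by
  by_contra! hne
  refine hx.ne' ?_
  rw [cylProb, Measure.real, ENNReal.toReal_eq_zero_iff]
  refine Or.inl (measure_mono_null (t := (SFT A)ᶜ) (fun y hy hyA => hne y hyA hy) ?_)
  exact hμ.ae_mem

theorem markovWeight_pos [IsFiniteMeasure μ] (hpos : ∀ x ∈ SFT A, 0 < cylProb μ (n + 1) x)
    {z : ℤ → Fin k} (hz : z ∈ SFT A) (M : ℕ) : 0 < markovWeight μ n M z := by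
  have h : ∀ x ∈ SFT A, 0 < cylProb μ n x := fun x hx =>
    (hpos x hx).trans_le (cylProb_antitone μ (Nat.le_succ n) x)
  exact mul_pos (h z hz) (Finset.prod_pos fun i _ =>
    div_pos (hpos _ (slide_mem_SFT hz i)) (h _ (slide_mem_SFT hz i)))

namespace IsMarkovApprox

theorem invProbOn (h : IsMarkovApprox n μ ν) (hn : 1 ≤ n) (hμ : InvProbOn A μ) :
    InvProbOn A ν := by
  have := h.isProb
  have := hμ.1
  refine ⟨h.isProb, h.invariant, ?_⟩
  have h0 : ∀ᵐ x ∂ν, A (x 0) (x 1) = 1 := by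
    filter_upwards [ae_cylProb_pos ν (n + 1)] with x hx
    rw [h.cylProb_eq_succ] at hx
    obtain ⟨y, hy, hyx⟩ := hμ.exists_mem_word_eq hx
    rw [word_eq_iff] at hyx
    rw [← hyx 0 le_rfl (by push_cast; omega), ← hyx 1 (by omega) (by push_cast; omega)]
    exact hy 0
  have h1 : ∀ᵐ x ∂ν, x ∈ SFT A := by
    refine ae_all_iff.2 fun i => ?_
    filter_upwards [(measurePreserving_slide h.invariant i).quasiMeasurePreserving.ae h0] with x hx
    simpa [slide, add_comm] using hx
  exact (mem_ae_iff_prob_eq_one measurableSet_SFT).1 h1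

theorem ergodic_of_cylProb_pos [NeZero k] (h : IsMarkovApprox n μ ν)
    (h01 : ∀ i j, A i j = 0 ∨ A i j = 1) (hirr : IrreducibleMat A) (hn : 1 ≤ n)
    (hμ : InvProbOn A μ) (hpos : ∀ x ∈ SFT A, 0 < cylProb μ (n + 1) x) :
    Ergodic (slide 1) ν := by
  have := h.isProb
  have := hμ.1
  have hν := h.invProbOn hn hμ
  refine h.ergodic fun x y hx hy => ?_
  obtain ⟨x', hx', hxx⟩ := hν.exists_mem_word_eq hx
  obtain ⟨y', hy', hyy⟩ := hν.exists_mem_word_eq hy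
  obtain ⟨z, hz, R, hz1, hz2⟩ := exists_glue h01 hirr hx' hy' n
  refine ⟨R, (markovWeight_pos hpos hz R).trans_le ?_⟩
  rw [← h.cylProb_eq, ← hxx, ← hyy, ← hz1, ← hz2]
  refine measureReal_mono fun v hv => ⟨word_mono (Nat.le_add_right n R) hv, ?_⟩
  exact word_slide (by omega) hv

end IsMarkovApprox

end SubshiftMarkov

section Observable

variable {k : ℕ} {ψ : (ℤ → Fin k) → ℝ}

theorem integrable_of_continuous (hψ : Continuous ψ) (μ : Measure (ℤ → Fin k)) [IsFiniteMeasure μ] :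
    Integrable ψ μ := by
  obtain ⟨C, hC⟩ := isCompact_univ.exists_bound_of_continuousOn hψ.continuousOn
  exact Integrable.of_bound hψ.aestronglyMeasurable C (ae_of_all _ fun x => hC x (Set.mem_univ x))

theorem exists_forall_abs_sub_le (hψ : Continuous ψ) {δ : ℝ} (hδ : 0 < δ) :
    ∃ R : ℕ, ∀ x y : ℤ → Fin k, (∀ i : ℤ, -R ≤ i → i < R → x i = y i) → |ψ x - ψ y| ≤ δ := by
  by_contra! hne
  let K : ℕ → Set ((ℤ → Fin k) × (ℤ → Fin k)) := fun R =>
    {q | (∀ i : ℤ, -R ≤ i → i < R → q.1 i = q.2 i) ∧ δ ≤ |ψ q.1 - ψ q.2|}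
  have hclosed : ∀ R, IsClosed (K R) := by
    intro R
    refine IsClosed.inter ?_ (isClosed_le continuous_const
      ((hψ.comp continuous_fst).sub (hψ.comp continuous_snd)).abs)
    have : {q : (ℤ → Fin k) × (ℤ → Fin k) | ∀ i : ℤ, -R ≤ i → i < R → q.1 i = q.2 i} =
        ⋂ i : ℤ, ⋂ (_ : -R ≤ i), ⋂ (_ : i < R), {q | q.1 i = q.2 i} := by
      ext q; simp
    change IsClosed {q : (ℤ → Fin k) × (ℤ → Fin k) | ∀ i : ℤ, -R ≤ i → i < R → q.1 i = q.2 i}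
    rw [this]
    exact isClosed_iInter fun i => isClosed_iInter fun _ => isClosed_iInter fun _ =>
      isClosed_eq (by fun_prop) (by fun_prop)
  obtain ⟨q, hq⟩ := IsCompact.nonempty_iInter_of_sequence_nonempty_isCompact_isClosed K
    (fun R q hq => ⟨fun i h0 h1 => hq.1 i (by push_cast; omega) (by push_cast; omega), hq.2⟩)
    (fun R => by
      obtain ⟨x, y, h, h'⟩ := hne R
      exact ⟨(x, y), h, h'.le⟩) (hclosed 0).isCompact hclosed
  rw [Set.mem_iInter] at hq
  have : q.1 = q.2 := by
    funext i
    exact (hq (i.natAbs + 1)).1 i (by omega) (by omega)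
  have h2 := (hq 0).2
  rw [this, sub_self, abs_zero] at h2
  linarith

/-- The integral of a continuous function with respect to an invariant measure is determined, up
to an error uniform in the measure, by the probabilities of sufficiently long words. -/
theorem exists_forall_abs_integral_sub_le [NeZero k] (hψ : Continuous ψ) {δ : ℝ} (hδ : 0 < δ) :
    ∃ J₀ : ℕ, ∀ J, J₀ ≤ J → ∃ g : (Fin J → Fin k) → ℝ, ∀ μ : Measure (ℤ → Fin k),
      IsProbabilityMeasure μ → MeasurePreserving (slide 1) μ μ →
        |∫ x, ψ x ∂μ - ∑ w, cylProb μ J (extendWord J w) * g w| ≤ δ := by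
  obtain ⟨R, hR⟩ := exists_forall_abs_sub_le hψ hδ
  refine ⟨2 * R, fun J hJ => ⟨fun w => ψ (slide R (extendWord J w)), fun μ hμ hinv => ?_⟩⟩
  have h1 := integral_word μ J fun w => ψ (slide R (extendWord J w))
  have h2 := integral_slide hinv (-R) fun x => ψ (slide R (extendWord J (word J x)))
  have hψi : Integrable (fun x => ψ (slide R (extendWord J (word J (slide (-R) x))))) μ :=
    (measurePreserving_slide hinv (-R)).integrable_comp_of_integrable
      (integrable_word μ J fun w => ψ (slide R (extendWord J w)))
  simp_rw [cylProb_extendWord]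
  rw [← h1, ← h2, ← integral_sub (integrable_of_continuous hψ μ) hψi]
  have hb : ∀ x : ℤ → Fin k,
      ‖ψ x - ψ (slide R (extendWord J (word J (slide (-R) x))))‖ ≤ δ := fun x =>
    hR _ _ fun i h0 h1 => (slide_extendWord_apply x hJ h0 h1).symm
  have h3 := norm_integral_le_of_norm_le_const (μ := μ) (ae_of_all _ hb)
  rwa [probReal_univ, mul_one] at h3

end Observable

section Family

variable {k n : ℕ} {A : Fin k → Fin k → ℕ} {ψ : (ℤ → Fin k) → ℝ} {μ ν lam₀ lam₁ : Measure (ℤ → Fin k)}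

theorem cylProb_mix {t : ℝ} (ht : t ∈ Set.Icc (0 : ℝ) 1) [IsFiniteMeasure lam₀]
    [IsFiniteMeasure lam₁] (j : ℕ) (x : ℤ → Fin k) :
    cylProb (mix t lam₀ lam₁) j x = (1 - t) * cylProb lam₀ j x + t * cylProb lam₁ j x :=
  measureReal_mix ht.1 ht.2 _ _ _

theorem continuousOn_cylProb_mix [IsFiniteMeasure lam₀] [IsFiniteMeasure lam₁] (j : ℕ)
    (x : ℤ → Fin k) : ContinuousOn (fun t => cylProb (mix t lam₀ lam₁) j x) (Set.Icc 0 1) :=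
  ContinuousOn.congr (f := fun t => (1 - t) * cylProb lam₀ j x + t * cylProb lam₁ j x)
    (by fun_prop) fun _ ht => cylProb_mix ht j x

theorem continuousOn_blockH_mix [NeZero k] [IsFiniteMeasure lam₀] [IsFiniteMeasure lam₁] (j : ℕ) :
    ContinuousOn (fun t => blockH (mix t lam₀ lam₁) j) (Set.Icc 0 1) := by
  simp_rw [blockH_eq_sum, ← cylProb_extendWord]
  exact continuousOn_finsetSum _ fun w _ =>
    Real.continuous_negMulLog.comp_continuousOn (continuousOn_cylProb_mix j _)

theorem continuousOn_transProb_mix (h₀ : InvProbOn A lam₀) (h₁ : InvProbOn A lam₁)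
    (hpos : ∀ x ∈ SFT A, 0 < cylProb lam₁ (n + 1) x) (x : ℤ → Fin k) :
    ContinuousOn (fun t => transProb (mix t lam₀ lam₁) n x) (Set.Ioc 0 1) := by
  have := h₀.1
  have := h₁.1
  by_cases hx : cylProb lam₁ n x = 0
  · have hx₀ : cylProb lam₀ n x = 0 := by
      by_contra hne
      obtain ⟨y, hy, hyx⟩ := h₀.exists_mem_word_eq ((cylProb_nonneg _ _ _).lt_of_ne' hne)
      rw [← cylProb_congr _ hyx] at hx
      exact ((hpos y hy).trans_le (cylProb_antitone _ (Nat.le_succ n) y)).ne' hx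
    refine (continuousOn_const (c := (0 : ℝ))).congr fun t ht => ?_
    rw [transProb, cylProb_mix (lam₀ := lam₀) ⟨ht.1.le, ht.2⟩ n, hx, hx₀, mul_zero, mul_zero, add_zero, div_zero]
  · refine ((continuousOn_cylProb_mix _ x).mono Set.Ioc_subset_Icc_self).div
      ((continuousOn_cylProb_mix _ x).mono Set.Ioc_subset_Icc_self) fun t ht => ?_
    rw [cylProb_mix ⟨ht.1.le, ht.2⟩]
    have h1 := mul_nonneg (sub_nonneg.2 ht.2) (cylProb_nonneg lam₀ n x)
    have h2 := mul_pos ht.1 ((cylProb_nonneg lam₁ n x).lt_of_ne' hx)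
    linarith

theorem continuousOn_integral_markovApprox [NeZero k] (hψ : Continuous ψ) (h₀ : InvProbOn A lam₀)
    (h₁ : InvProbOn A lam₁) (hpos : ∀ x ∈ SFT A, 0 < cylProb lam₁ (n + 1) x)
    {ν : ℝ → Measure (ℤ → Fin k)}
    (hν : ∀ t ∈ Set.Ioc (0 : ℝ) 1, IsMarkovApprox n (mix t lam₀ lam₁) (ν t)) :
    ContinuousOn (fun t => ∫ x, ψ x ∂(ν t)) (Set.Ioc 0 1) := by
  have := h₀.1
  have := h₁.1
  refine continuousOn_of_uniform_approx_of_continuousOn fun u hu => ?_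
  obtain ⟨ε, hε, hεu⟩ := Metric.mem_uniformity_dist.1 hu
  obtain ⟨M, hM⟩ := exists_forall_abs_integral_sub_le hψ (half_pos hε)
  obtain ⟨g, hg⟩ := hM (n + M) (by omega)
  refine ⟨fun t => ∑ w, markovWeight (mix t lam₀ lam₁) n M (extendWord (n + M) w) * g w, ?_,
    fun t ht => hεu ?_⟩
  · refine continuousOn_finsetSum _ fun w _ => ContinuousOn.mul ?_ continuousOn_const
    refine ((continuousOn_cylProb_mix _ _).mono Set.Ioc_subset_Icc_self).mul ?_
    exact continuousOn_finsetProd _ fun i _ => continuousOn_transProb_mix h₀ h₁ hpos _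
  · have := hg (ν t) (hν t ht).isProb (hν t ht).invariant
    simp_rw [(hν t ht).cylProb_eq] at this
    rw [Real.dist_eq]
    linarith

theorem IsMarkovApprox.abs_integral_sub_le [NeZero k] [IsProbabilityMeasure μ]
    (h : IsMarkovApprox n μ ν) (hμ : MeasurePreserving (slide 1) μ μ) {δ : ℝ}
    {g : (Fin n → Fin k) → ℝ} (hg : ∀ μ : Measure (ℤ → Fin k),
      IsProbabilityMeasure μ → MeasurePreserving (slide 1) μ μ →
        |∫ x, ψ x ∂μ - ∑ w, cylProb μ n (extendWord n w) * g w| ≤ δ) :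
    |∫ x, ψ x ∂ν - ∫ x, ψ x ∂μ| ≤ 2 * δ := by
  have h1 := hg ν h.isProb h.invariant
  have h2 := hg μ inferInstance hμ
  simp_rw [h.cylProb_eq_self] at h1
  rw [abs_le] at *
  constructor <;> linarith

theorem le_integral_of_forall_le (hψ : Continuous ψ) {c : ℝ} (hc : ∀ x ∈ SFT A, c ≤ ψ x)
    (hμ : InvProbOn A μ) : c ≤ ∫ x, ψ x ∂μ := by
  have := hμ.1
  have := integral_mono_ae (integrable_const c) (integrable_of_continuous hψ μ)
    (hμ.ae_mem.mono hc)
  simpa using this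

theorem exists_continuous_eqOn {φ : (ℤ → Fin k) → ℝ} (hφ : ContinuousOn φ (SFT A)) :
    ∃ ψ : (ℤ → Fin k) → ℝ, Continuous ψ ∧ Set.EqOn φ ψ (SFT A) := by
  obtain ⟨g, hg⟩ := ContinuousMap.exists_restrict_eq isClosed_SFT
    (⟨(SFT A).domRestrict φ, hφ.domRestrict⟩ : C(SFT A, ℝ))
  exact ⟨g, g.continuous, fun x hx => (DFunLike.congr_fun hg ⟨x, hx⟩).symm⟩

theorem setIntegral_SFT_eq {φ : (ℤ → Fin k) → ℝ} (h : Set.EqOn φ ψ (SFT A)) (hμ : InvProbOn A μ) :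
    ∫ x in SFT A, φ x ∂μ = ∫ x, ψ x ∂μ := by
  rw [setIntegral_congr_fun measurableSet_SFT h, Measure.restrict_eq_self_of_ae_mem hμ.ae_mem]

end Family

section Intermediate

variable {k : ℕ} {A : Fin k → Fin k → ℕ} {ψ : (ℤ → Fin k) → ℝ}

theorem mix_zero (μ ν : Measure (ℤ → Fin k)) : mix 0 μ ν = μ := by simp [mix]

theorem mix_one (μ ν : Measure (ℤ → Fin k)) : mix 1 μ ν = ν := by simp [mix]

theorem exists_mem_Ioc_pos {f : ℝ → ℝ} (hf : ContinuousOn f (Set.Icc 0 1)) (h0 : 0 < f 0) :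
    ∃ t ∈ Set.Ioc (0 : ℝ) 1, 0 < f t := by
  have h1 : ∀ᶠ t in 𝓝[Set.Icc 0 1] (0 : ℝ), 0 < f t :=
    (hf 0 (by simp)).eventually_const_lt h0
  have h2 : ∀ᶠ t in 𝓝[Set.Ioc 0 1] (0 : ℝ), 0 < f t :=
    h1.filter_mono (nhdsWithin_mono _ Set.Ioc_subset_Icc_self)
  rw [nhdsWithin_Ioc_eq_nhdsGT one_pos] at h2
  obtain ⟨t, ht, ht0, ht1⟩ := (h2.and (Ioc_mem_nhdsGT one_pos)).exists
  exact ⟨t, ⟨ht0, ht1⟩, ht⟩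

theorem exists_ergodic_mEntropy_eq [NeZero k] (h01 : ∀ i j, A i j = 0 ∨ A i j = 1)
    (hirr : IrreducibleMat A) (hψ : Continuous ψ) (hψpos : ∀ x ∈ SFT A, 0 < ψ x) {h : ℝ}
    (hh : 0 < h) {μ : Measure (ℤ → Fin k)} (hμ : InvProbOn A μ)
    (hμh : h * ∫ x, ψ x ∂μ < mEntropy μ) :
    ∃ ν : Measure (ℤ → Fin k), InvProbOn A ν ∧ Ergodic (slide 1) ν ∧
      mEntropy ν = h * ∫ x, ψ x ∂ν := by
  have := hμ.1
  have hne : (SFT A).Nonempty := by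
    rw [Set.nonempty_iff_ne_empty]
    intro he
    have := hμ.2.2
    simp [he] at this
  obtain ⟨x₀, hx₀, hmin⟩ := isClosed_SFT.isCompact.exists_isMinOn hne hψ.continuousOn
  have hc : ∀ ν : Measure (ℤ → Fin k), InvProbOn A ν → ψ x₀ ≤ ∫ x, ψ x ∂ν := fun ν hν =>
    le_integral_of_forall_le hψ (fun x hx => hmin hx) hν
  obtain ⟨δ, hδ, hμδ⟩ : ∃ δ > 0, h * (∫ x, ψ x ∂μ + 2 * δ) < mEntropy μ := by
    refine ⟨(mEntropy μ - h * ∫ x, ψ x ∂μ) / (4 * h), div_pos (by linarith) (by linarith), ?_⟩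
    rw [show h * (∫ x, ψ x ∂μ + 2 * ((mEntropy μ - h * ∫ x, ψ x ∂μ) / (4 * h))) =
      (mEntropy μ + h * ∫ x, ψ x ∂μ) / 2 by field_simp; ring]
    linarith
  obtain ⟨z, hz, p, hp, hpz, -⟩ := exists_periodic h01 hirr hx₀ 0
  have hlam₀ := invProbOn_orbitMeasure hz hp hpz
  set lam₀ := orbitMeasure z p
  have := hlam₀.1
  obtain ⟨J, hJ⟩ := exists_forall_abs_integral_sub_le hψ hδ
  obtain ⟨n, hn, hnμ⟩ := exists_mEntropy_sub_lt (J + p) hμδ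
  obtain ⟨g, hg⟩ := hJ n (by omega)
  obtain ⟨ρ, hρ, hρpos⟩ := exists_invProbOn_cylProb_pos h01 hirr hne (n + 1)
  have := hρ.1
  have hψi : ∀ (ν : Measure (ℤ → Fin k)), IsFiniteMeasure ν → Integrable ψ ν := fun ν _ =>
    integrable_of_continuous hψ ν
  have hcont_mix : ContinuousOn (fun t => ∫ x, ψ x ∂(mix t μ ρ)) (Set.Icc 0 1) :=
    ContinuousOn.congr (f := fun t => (1 - t) * ∫ x, ψ x ∂μ + t * ∫ x, ψ x ∂ρ) (by fun_prop)
      fun t ht => integral_mix ht.1 ht.2 (hψi μ inferInstance) (hψi ρ inferInstance)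
  obtain ⟨s, hs, hspos⟩ := exists_mem_Ioc_pos (f := fun t => blockH (mix t μ ρ) (n + 1) -
      blockH (mix t μ ρ) n - h * (∫ x, ψ x ∂(mix t μ ρ) + 2 * δ))
    (((continuousOn_blockH_mix _).sub (continuousOn_blockH_mix _)).sub
      (continuousOn_const.mul (hcont_mix.add continuousOn_const)))
    (by simp only [mix_zero]; linarith)
  have hlam₁ : InvProbOn A (mix s μ ρ) := hμ.mix hs.1.le hs.2 hρ
  have hpos : ∀ x ∈ SFT A, 0 < cylProb (mix s μ ρ) (n + 1) x := by
    intro x hx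
    rw [cylProb_mix ⟨hs.1.le, hs.2⟩]
    have h1 := mul_nonneg (sub_nonneg.2 hs.2) (cylProb_nonneg μ (n + 1) x)
    have h2 := mul_pos hs.1 (hρpos x hx)
    linarith
  set lam₁ := mix s μ ρ
  have := hlam₁.1
  have hmix : ∀ t ∈ Set.Ioc (0 : ℝ) 1, InvProbOn A (mix t lam₀ lam₁) := fun t ht =>
    hlam₀.mix ht.1.le ht.2 hlam₁
  have hex : ∀ t : ℝ, ∃ ν : Measure (ℤ → Fin k), t ∈ Set.Ioc (0 : ℝ) 1 →
      IsMarkovApprox n (mix t lam₀ lam₁) ν := by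
    intro t
    by_cases ht : t ∈ Set.Ioc (0 : ℝ) 1
    · have := (hmix t ht).1
      obtain ⟨ν, hν⟩ := exists_isMarkovApprox (hmix t ht).invariant n
      exact ⟨ν, fun _ => hν⟩
    · exact ⟨0, fun h => absurd h ht⟩
  choose ν hν using hex
  have hνinv : ∀ t ∈ Set.Ioc (0 : ℝ) 1, InvProbOn A (ν t) := fun t ht =>
    (hν t ht).invProbOn (by omega) (hmix t ht)
  set E : ℝ → ℝ := fun t => blockH (mix t lam₀ lam₁) (n + 1) - blockH (mix t lam₀ lam₁) n with hE
  have hEcont : ContinuousOn E (Set.Icc 0 1) :=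
    (continuousOn_blockH_mix _).sub (continuousOn_blockH_mix _)
  have hE0 : E 0 = 0 := by
    simp only [hE, mix_zero]
    rw [blockH_succ_eq_of_periodic hp (ae_orbitMeasure hpz) (by omega), sub_self]
  obtain ⟨t₀, ht₀, hEt₀⟩ := exists_mem_Ioc_pos (f := fun t => h * ψ x₀ - E t)
    (continuousOn_const.sub hEcont) (by rw [hE0, sub_zero]; exact mul_pos hh (hψpos _ hx₀))
  have hsub : Set.Icc t₀ 1 ⊆ Set.Ioc 0 1 := fun t ht => ⟨ht₀.1.trans_le ht.1, ht.2⟩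
  have hGcont : ContinuousOn (fun t => E t - h * ∫ x, ψ x ∂(ν t)) (Set.Icc t₀ 1) :=
    (hEcont.mono (hsub.trans Set.Ioc_subset_Icc_self)).sub (continuousOn_const.mul
      ((continuousOn_integral_markovApprox hψ hlam₀ hlam₁ hpos hν).mono hsub))
  have hG₀ : E t₀ - h * ∫ x, ψ x ∂(ν t₀) ≤ 0 := by
    have := mul_le_mul_of_nonneg_left (hc _ (hνinv t₀ ht₀)) hh.le
    linarith
  have hG₁ : 0 ≤ E 1 - h * ∫ x, ψ x ∂(ν 1) := by
    have h1 : (1 : ℝ) ∈ Set.Ioc (0 : ℝ) 1 := by simp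
    have h2 := hν 1 h1
    rw [mix_one] at h2
    have h3 := (abs_le.1 (h2.abs_integral_sub_le hlam₁.invariant hg)).2
    have h4 := mul_le_mul_of_nonneg_left (show ∫ x, ψ x ∂(ν 1) ≤ ∫ x, ψ x ∂lam₁ + 2 * δ by linarith)
      hh.le
    simp only [hE, mix_one]
    linarith
  obtain ⟨t, ht, hGt⟩ := intermediate_value_Icc ht₀.2 hGcont ⟨hG₀, hG₁⟩
  have ht' := hsub ht
  have := (hmix t ht').1
  refine ⟨ν t, hνinv t ht', (hν t ht').ergodic_of_cylProb_pos h01 hirr (by omega) (hmix t ht')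
    fun x hx => ?_, ?_⟩
  · rw [cylProb_mix ⟨ht'.1.le, ht'.2⟩]
    have h1 := mul_nonneg (sub_nonneg.2 ht'.2) (cylProb_nonneg lam₀ (n + 1) x)
    have h2 := mul_pos ht'.1 (hpos x hx)
    linarith
  · rw [(hν t ht').mEntropy_eq]
    exact sub_eq_zero.1 hGt

end Intermediate

/-- Let `A` be an irreducible `k × k` 0-1 matrix and let
`φ : Σ_A → ℝ` be continuous and strictly positive. Let
`H = sup { h_μ(σ) / ∫ φ dμ : μ ∈ M_inv(σ, Σ_A) }` and assume `H > 0`. Then for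
every `h ∈ (0, H)` there is an ergodic `μ ∈ M_inv(σ, Σ_A)` with
`h_μ(σ) / ∫ φ dμ = h`. -/
theorem stmt4 {k : ℕ} (hk : 1 ≤ k) (A : Fin k → Fin k → ℕ)
    (h01 : ∀ i j, A i j = 0 ∨ A i j = 1) (hirr : IrreducibleMat A)
    (φ : (ℤ → Fin k) → ℝ) (hφcont : ContinuousOn φ (SFT A))
    (hφpos : ∀ x ∈ SFT A, 0 < φ x)
    (H : ℝ)
    (hH : H = sSup {r : ℝ | ∃ μ : Measure (ℤ → Fin k), InvProbOn A μ ∧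
      r = mEntropy μ / ∫ x in SFT A, φ x ∂μ})
    (hHpos : 0 < H) :
    ∀ h : ℝ, 0 < h → h < H →
      ∃ μ : Measure (ℤ → Fin k), InvProbOn A μ ∧ Ergodic shiftMap μ ∧
        mEntropy μ / (∫ x in SFT A, φ x ∂μ) = h := by
  intro h hh hhH
  have : NeZero k := ⟨by omega⟩
  obtain ⟨ψ, hψ, hφψ⟩ := exists_continuous_eqOn hφcont
  have hψpos : ∀ x ∈ SFT A, 0 < ψ x := fun x hx => hφψ hx ▸ hφpos x hx
  have hψi : ∀ μ : Measure (ℤ → Fin k), InvProbOn A μ → 0 < ∫ x, ψ x ∂μ := by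
    intro μ hμ
    have := hμ.1
    rw [integral_pos_iff_support_of_nonneg_ae (hμ.ae_mem.mono fun x hx => (hψpos x hx).le)
      (integrable_of_continuous hψ μ)]
    refine lt_of_lt_of_le ?_ (measure_mono (s := SFT A) fun x hx => (hψpos x hx).ne')
    rw [hμ.2.2]
    exact one_pos
  have hne : {r : ℝ | ∃ μ : Measure (ℤ → Fin k), InvProbOn A μ ∧
      r = mEntropy μ / ∫ x in SFT A, φ x ∂μ}.Nonempty := by
    rw [Set.nonempty_iff_ne_empty]
    intro he
    rw [he, Real.sSup_empty] at hH
    exact hHpos.ne' hH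
  obtain ⟨r, ⟨μ, hμ, rfl⟩, hr⟩ := exists_lt_of_lt_csSup hne (hH ▸ hhH)
  rw [setIntegral_SFT_eq hφψ hμ, lt_div_iff₀ (hψi μ hμ)] at hr
  obtain ⟨ν, hν, herg, hent⟩ := exists_ergodic_mEntropy_eq h01 hirr hψ hψpos hh hμ hr
  refine ⟨ν, hν, herg, ?_⟩
  rw [setIntegral_SFT_eq hφψ hν, hent, mul_div_cancel_right₀ _ (hψi ν hν).ne']
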